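/- arXiv:1409.2663 — 3 statements merged into one kernel-verified Lean document; each statement's English description precedes it below -/
import Mathlib

section
/- Let (M,Q) be an ℝ²-valued random vector such that M satisfies (IRT-1)–(IRT-3) for some κ > 0, E|Q|^κ < ∞, P(M > 0) = 1 and P(Mc + Q = c) < 1 for all c ∈ ℝ, and let X be the unique distributional solution of X =_d MX + Q (X independent of (M,Q)). Then the limit C₊ = lim_{t→∞} t^κ P(X > t) is positive if and only if the affine map x ↦ Mx + Q possesses no a.s. invariant half-line (−∞,c], i.e. if and only if P(Mc + Q > c) > 0 for all c ∈ ℝ. -/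
open MeasureTheory ProbabilityTheory Filter Set

noncomputable section

/-- Conditions (IRT-1)–(IRT-3) of Goldie's implicit renewal theorem. -/
def SatisfiesIRT {Θ : Type*} [MeasurableSpace Θ] (ν : Measure Θ) (M : Θ → ℝ) (κ : ℝ) :
    Prop :=
  0 < κ ∧
  (∫ p, |M p| ^ κ ∂ν) = 1 ∧
  Integrable (fun p => |M p| ^ κ * max (Real.log |M p|) 0) ν ∧
  ∀ c : ℝ, 0 < ν {p | M p ≠ 0 ∧ ∀ k : ℤ, Real.log |M p| ≠ c * k}

theorem tail_eq_integral {ν : Measure (ℝ × ℝ)} [IsProbabilityMeasure ν]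
    (hMpos : ∀ᵐ p ∂ν, 0 < p.1) {η : Measure ℝ} [IsProbabilityMeasure η]
    (hfix : Measure.map (fun q : ℝ × (ℝ × ℝ) => q.2.1 * q.1 + q.2.2) (η.prod ν) = η) (t : ℝ) :
    η.real (Ioi t) = ∫ p, η.real (Ioi ((t - p.2) / p.1)) ∂ν := by
  have hm : Measurable (fun q : ℝ × (ℝ × ℝ) => q.2.1 * q.1 + q.2.2) := by fun_prop
  have h1 : η (Ioi t) = ∫⁻ p, η (Ioi ((t - p.2) / p.1)) ∂ν := by
    conv_lhs => rw [← hfix]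
    rw [Measure.map_apply hm measurableSet_Ioi,
      Measure.prod_apply_symm (hm measurableSet_Ioi)]
    refine lintegral_congr_ae ?_
    filter_upwards [hMpos] with p hp
    congr 1
    ext x
    simp only [mem_preimage, mem_Ioi, div_lt_iff₀ hp]
    constructor <;> intro h <;> linarith
  have hF : Measurable fun s : ℝ => η (Ioi s) :=
    Antitone.measurable fun a b hab => measure_mono (Ioi_subset_Ioi hab)
  have hFp : Measurable fun p : ℝ × ℝ => η (Ioi ((t - p.2) / p.1)) :=
    hF.comp (by fun_prop : Measurable fun p : ℝ × ℝ => (t - p.2) / p.1)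
  simp only [measureReal_def]
  rw [integral_toReal hFp.aemeasurable
    (ae_of_all _ fun p => measure_lt_top _ _), h1]

theorem antitone_tail (η : Measure ℝ) [IsFiniteMeasure η] :
    Antitone fun t : ℝ => η.real (Ioi t) :=
  fun _ _ hab => measureReal_mono (Ioi_subset_Ioi hab)

theorem integrable_tail_comp {α : Type*} [MeasurableSpace α] (ν : Measure α) [IsFiniteMeasure ν]
    (η : Measure ℝ) [IsProbabilityMeasure η] {f : α → ℝ} (hf : Measurable f) :
    Integrable (fun p => η.real (Ioi (f p))) ν :=
  Integrable.of_bound (((antitone_tail η).measurable.comp hf).aestronglyMeasurable) 1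
    (ae_of_all _ fun p => by
      rw [Real.norm_of_nonneg measureReal_nonneg]
      exact measureReal_le_one)

theorem tail_pos {ν : Measure (ℝ × ℝ)} [IsProbabilityMeasure ν]
    (hMpos : ∀ᵐ p ∂ν, 0 < p.1) {η : Measure ℝ} [IsProbabilityMeasure η]
    (hfix : Measure.map (fun q : ℝ × (ℝ × ℝ) => q.2.1 * q.1 + q.2.2) (η.prod ν) = η)
    (hc : ∀ c : ℝ, 0 < ν {p | c < p.1 * c + p.2}) (t : ℝ) :
    0 < η.real (Ioi t) := by
  by_contra! h0
  have h0' : η (Ioi t) = 0 := by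
    have := le_antisymm h0 measureReal_nonneg
    rwa [measureReal_eq_zero_iff] at this
  set S : Set ℝ := {s | η (Ioi s) = 0} with hS
  have hne : S.Nonempty := ⟨t, h0'⟩
  have hbdd : BddBelow S := by
    have h1 : Tendsto (fun s : ℝ => η (Ioi s)) atBot (nhds (η univ)) := by
      have := tendsto_measure_iUnion_atBot (μ := η) (s := fun s : ℝ => Ioi s)
        (fun a b hab => Ioi_subset_Ioi hab)
      rwa [iUnion_Ioi] at this
    rw [measure_univ] at h1
    obtain ⟨b, hb⟩ := eventually_atBot.1 (h1.eventually_ne one_ne_zero)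
    exact ⟨b, fun s hs => le_of_lt (not_le.1 fun hsb => hb s hsb hs)⟩
  set c := sInf S with hcdef
  have hlt : ∀ s, η (Ioi s) = 0 → c ≤ s := fun s hs => csInf_le hbdd hs
  have hgt : ∀ s, c < s → η (Ioi s) = 0 := by
    intro s hs
    obtain ⟨u, hu, hus⟩ := exists_lt_of_csInf_lt hne hs
    exact measure_mono_null (Ioi_subset_Ioi hus.le) hu
  have hc0 : η (Ioi c) = 0 := by
    have : Ioi c = ⋃ n : ℕ, Ioi (c + 1 / ((n : ℝ) + 1)) := by
      ext x
      simp only [mem_Ioi, mem_iUnion]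
      constructor
      · intro hx
        obtain ⟨n, hn⟩ := exists_nat_one_div_lt (sub_pos.2 hx)
        exact ⟨n, by linarith⟩
      · rintro ⟨n, hn⟩
        have : (0 : ℝ) < 1 / ((n : ℝ) + 1) := by positivity
        linarith
    rw [this, measure_iUnion_null_iff]
    intro n
    have : (0 : ℝ) < 1 / ((n : ℝ) + 1) := by positivity
    exact hgt _ (by linarith)
  have h_int := tail_eq_integral hMpos hfix c
  rw [measureReal_def, hc0, ENNReal.toReal_zero] at h_int
  have hz := (integral_eq_zero_iff_of_nonneg (fun p => measureReal_nonneg)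
    (integrable_tail_comp ν η (f := fun p : ℝ × ℝ => (c - p.2) / p.1) (by fun_prop))).1 h_int.symm
  refine (hc c).ne' ?_
  rw [← compl_mem_ae_iff]
  filter_upwards [hz, hMpos] with p hp hpos
  have h1 := hlt _ ((measureReal_eq_zero_iff).1 hp)
  rw [le_div_iff₀ hpos] at h1
  simp only [mem_compl_iff, mem_ofPred_eq, not_lt]
  linarith

theorem integrable_rpow_abs_mul_log {Θ : Type*} [MeasurableSpace Θ] {ν : Measure Θ}
    [IsProbabilityMeasure ν] {M : Θ → ℝ} (hM : Measurable M) {κ : ℝ} (h : SatisfiesIRT ν M κ) :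
    Integrable (fun p => |M p| ^ κ * Real.log |M p|) ν := by
  obtain ⟨hκ, -, hlog, -⟩ := h
  refine Integrable.mono' (hlog.add (integrable_const (1 / κ)))
    (by fun_prop) (ae_of_all _ fun p => ?_)
  simp only [Pi.add_apply]
  have hx0 := abs_nonneg (M p)
  set x := |M p|
  have hw : 0 ≤ x ^ κ := Real.rpow_nonneg hx0 _
  have hk : 0 < 1 / κ := by positivity
  rcases le_total 1 x with hx | hx
  · have := Real.log_nonneg hx
    rw [max_eq_left this, Real.norm_of_nonneg (mul_nonneg hw this)]
    linarith
  · have hl : Real.log x ≤ 0 := Real.log_nonpos hx0 hx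
    rw [max_eq_right hl, mul_zero, zero_add]
    rcases hx0.eq_or_lt with h0 | h0
    · rw [← h0]; simpa using hκ.le
    · have := Real.abs_log_mul_self_rpow_lt x κ h0 hx hκ
      rw [mul_comm, Real.norm_eq_abs]
      exact this.le

theorem SatisfiesIRT.integrable {Θ : Type*} [MeasurableSpace Θ] {ν : Measure Θ}
    {M : Θ → ℝ} {κ : ℝ} (h : SatisfiesIRT ν M κ) : Integrable (fun p => |M p| ^ κ) ν := by
  by_contra hc
  have := h.2.1
  rw [integral_undef hc] at this
  exact zero_ne_one this

theorem SatisfiesIRT.integral_rpow_mul_log_pos {Θ : Type*} [MeasurableSpace Θ] {ν : Measure Θ}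
    [IsProbabilityMeasure ν] {M : Θ → ℝ} (hM : Measurable M) {κ : ℝ} (h : SatisfiesIRT ν M κ) :
    0 < ∫ p, |M p| ^ κ * Real.log |M p| ∂ν := by
  have hκ := h.1
  have hW := h.integrable
  have hL := integrable_rpow_abs_mul_log hM h
  have key : ∀ x : ℝ, 0 < x → x ≠ 1 → 0 < κ * (x ^ κ * Real.log x) - x ^ κ + 1 := by
    intro x hx hx1
    have hy : 0 < x ^ κ := Real.rpow_pos_of_pos hx κ
    have hy1 : x ^ κ ≠ 1 := by
      rw [Ne, ← Real.one_rpow κ, Real.rpow_left_inj hx.le zero_le_one hκ.ne']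
      exact hx1
    have h1 := Real.log_lt_sub_one_of_pos (inv_pos.2 hy) (by simpa using hy1)
    rw [Real.log_inv, Real.log_rpow hx] at h1
    have h2 := mul_lt_mul_of_pos_left h1 hy
    have h3 : x ^ κ * ((x ^ κ)⁻¹ - 1) = 1 - x ^ κ := by field_simp
    rw [h3] at h2
    linarith
  have hsub : Integrable (fun p => κ * (|M p| ^ κ * Real.log |M p|) - |M p| ^ κ) ν :=
    (hL.const_mul κ).sub hW
  have h_int : Integrable (fun p => κ * (|M p| ^ κ * Real.log |M p|) - |M p| ^ κ + 1) ν :=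
    hsub.add (integrable_const 1)
  have hnn : 0 ≤ fun p => κ * (|M p| ^ κ * Real.log |M p|) - |M p| ^ κ + 1 := by
    intro p
    rcases (abs_nonneg (M p)).eq_or_lt with h0 | h0
    · simp [← h0, Real.zero_rpow hκ.ne']
    · rcases eq_or_ne |M p| 1 with h1 | h1
      · simp [h1]
      · exact (key _ h0 h1).le
  have hpos : 0 < ∫ p, (κ * (|M p| ^ κ * Real.log |M p|) - |M p| ^ κ + 1) ∂ν := by
    rw [integral_pos_iff_support_of_nonneg hnn h_int]
    refine (h.2.2.2 0).trans_le (measure_mono ?_)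
    rintro p ⟨hp0, hp⟩
    refine (key _ (abs_pos.2 hp0) ?_).ne'
    intro h1
    exact hp 0 (by simp [h1])
  rw [integral_add hsub (integrable_const 1),
    integral_sub (hL.const_mul κ) hW, h.2.1, integral_const_mul] at hpos
  simp only [integral_const, probReal_univ, one_smul, sub_add_cancel] at hpos
  exact pos_of_mul_pos_right hpos hκ.le

theorem SatisfiesIRT.integral_rpow_half_lt_one {Θ : Type*} [MeasurableSpace Θ] {ν : Measure Θ}
    [IsProbabilityMeasure ν] {M : Θ → ℝ} (hM : Measurable M) {κ : ℝ} (h : SatisfiesIRT ν M κ) :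
    Integrable (fun p => |M p| ^ (κ / 2)) ν ∧ ∫ p, |M p| ^ (κ / 2) ∂ν < 1 := by
  have hκ := h.1
  have hW := h.integrable
  have hsq : ∀ p, |M p| ^ κ = (|M p| ^ (κ / 2)) ^ 2 := by
    intro p
    rw [← Real.rpow_natCast, ← Real.rpow_mul (abs_nonneg _)]
    congr 1
    push_cast
    ring
  have hI : Integrable (fun p => |M p| ^ (κ / 2)) ν := by
    refine Integrable.mono' (hW.add (integrable_const 1))
      (hM.abs.pow_const _).aestronglyMeasurable (ae_of_all _ fun p => ?_)
    rw [Real.norm_of_nonneg (Real.rpow_nonneg (abs_nonneg _) _)]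
    simp only [Pi.add_apply, hsq p]
    nlinarith [sq_nonneg (|M p| ^ (κ / 2) - 1), sq_nonneg (|M p| ^ (κ / 2))]
  refine ⟨hI, ?_⟩
  have hadd : Integrable (fun p => |M p| ^ κ + 1) ν := hW.add (integrable_const 1)
  have h_int : Integrable (fun p => |M p| ^ κ + 1 - 2 * |M p| ^ (κ / 2)) ν :=
    hadd.sub (hI.const_mul 2)
  have hpos : 0 < ∫ p, (|M p| ^ κ + 1 - 2 * |M p| ^ (κ / 2)) ∂ν := by
    rw [integral_pos_iff_support_of_nonneg (fun p => ?_) h_int]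
    · refine (h.2.2.2 0).trans_le (measure_mono ?_)
      rintro p ⟨hp0, hp⟩
      have h1 : |M p| ^ (κ / 2) ≠ 1 := by
        rw [Ne, ← Real.one_rpow (κ / 2),
          Real.rpow_left_inj (abs_nonneg _) zero_le_one (by positivity)]
        intro h1
        exact hp 0 (by simp [h1])
      have : 0 < (|M p| ^ (κ / 2) - 1) ^ 2 := by
        have := sub_ne_zero.2 h1
        positivity
      refine ne_of_gt ?_
      simp only [hsq p]
      linarith
    · simp only [Pi.zero_apply, hsq p]
      nlinarith [sq_nonneg (|M p| ^ (κ / 2) - 1)]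
  rw [integral_sub hadd (hI.const_mul 2),
    integral_add hW (integrable_const 1), h.2.1, integral_const_mul] at hpos
  simp at hpos
  linarith

theorem tail_eq_zero_of_invariant_halfLine {ν : Measure (ℝ × ℝ)} [IsProbabilityMeasure ν] {κ : ℝ}
    (hIRT : SatisfiesIRT ν (fun p => p.1) κ)
    (hMpos : ∀ᵐ p ∂ν, 0 < p.1) {η : Measure ℝ} [IsProbabilityMeasure η]
    (hfix : Measure.map (fun q : ℝ × (ℝ × ℝ) => q.2.1 * q.1 + q.2.2) (η.prod ν) = η)
    {c B : ℝ} (hc : ∀ᵐ p ∂ν, p.1 * c + p.2 ≤ c)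
    (hB : ∀ t : ℝ, 0 < t → η.real (Ioi (c + t)) ≤ B * t ^ (-(κ / 2))) {t : ℝ} (ht : 0 < t) :
    η.real (Ioi (c + t)) = 0 := by
  obtain ⟨hI, hlt⟩ := hIRT.integral_rpow_half_lt_one measurable_fst
  set θ := ∫ p : ℝ × ℝ, |p.1| ^ (κ / 2) ∂ν with hθ
  have hθ0 : 0 ≤ θ := integral_nonneg fun p => Real.rpow_nonneg (abs_nonneg _) _
  have step : ∀ n : ℕ, ∀ t : ℝ, 0 < t → η.real (Ioi (c + t)) ≤ θ ^ n * B * t ^ (-(κ / 2)) := by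
    intro n
    induction n with
    | zero => simpa using hB
    | succ n ih =>
      intro t ht
      rw [tail_eq_integral hMpos hfix]
      calc ∫ p, η.real (Ioi ((c + t - p.2) / p.1)) ∂ν
          ≤ ∫ p, θ ^ n * B * t ^ (-(κ / 2)) * |p.1| ^ (κ / 2) ∂ν := by
            refine integral_mono_ae (integrable_tail_comp ν η (by fun_prop))
              (hI.const_mul _) ?_
            filter_upwards [hMpos, hc] with p hp hpc
            have h1 : c + t / p.1 ≤ (c + t - p.2) / p.1 := by
              rw [le_div_iff₀ hp, add_mul, div_mul_cancel₀ _ hp.ne']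
              linarith
            refine ((antitone_tail η) h1).trans ((ih _ (div_pos ht hp)).trans_eq ?_)
            rw [Real.div_rpow ht.le hp.le, Real.rpow_neg hp.le, abs_of_pos hp, div_inv_eq_mul]
            ring
        _ = θ ^ (n + 1) * B * t ^ (-(κ / 2)) := by
            rw [integral_const_mul, ← hθ]
            ring
  refine le_antisymm ?_ measureReal_nonneg
  have hlim : Tendsto (fun n : ℕ => θ ^ n * B * t ^ (-(κ / 2)))
      atTop (nhds (0 * B * t ^ (-(κ / 2)))) :=
    ((tendsto_pow_atTop_nhds_zero_of_lt_one hθ0 hlt).mul_const B).mul_const _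
  rw [zero_mul, zero_mul] at hlim
  exact ge_of_tendsto' hlim fun n => step n t ht

theorem log_one_add_div_ge {b t t' : ℝ} (hb : 0 < b) (ht : 0 < t) (ht' : 0 < t') :
    Real.log (1 + b / t) + b / (t + b) * Real.log (t / t') ≤ Real.log (1 + b / t') := by
  have hc := strictConcaveOn_log_Ioi.concaveOn.2 (mem_Ioi.2 one_pos)
    (mem_Ioi.2 (div_pos ht ht')) (by positivity : 0 ≤ t / (t + b))
    (by positivity : 0 ≤ b / (t + b)) (by field_simp)
  simp only [smul_eq_mul, Real.log_one, mul_zero, zero_add, mul_one] at hc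
  have h1 : t / (t + b) + b / (t + b) * (t / t') = (1 + b / t') / (1 + b / t) := by
    field_simp
  have h2 : Real.log ((1 + b / t') / (1 + b / t)) = Real.log (1 + b / t') - Real.log (1 + b / t) :=
    Real.log_div (by positivity) (by positivity)
  rw [h1, h2] at hc
  linarith

/-- A scale dominating both coordinates. -/
def affineScale (p : ℝ × ℝ) : ℝ := 1 + 2 * |p.1| + 2 * |p.2|

theorem one_le_affineScale (p : ℝ × ℝ) : 1 ≤ affineScale p := by
  unfold affineScale
  have := abs_nonneg p.1
  have := abs_nonneg p.2
  linarith

theorem affineScale_pos (p : ℝ × ℝ) : 0 < affineScale p :=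
  one_pos.trans_le (one_le_affineScale p)

theorem measurable_affineScale : Measurable affineScale := by
  unfold affineScale
  fun_prop

theorem integrable_rpow_affineScale {ν : Measure (ℝ × ℝ)} [IsProbabilityMeasure ν] {κ : ℝ}
    (hκ : 0 < κ) (hM : Integrable (fun p : ℝ × ℝ => |p.1| ^ κ) ν)
    (hQ : Integrable (fun p : ℝ × ℝ => |p.2| ^ κ) ν) :
    Integrable (fun p => (1 + affineScale p) ^ κ) ν := by
  have hm := measurable_affineScale
  refine Integrable.mono' ((((integrable_const (1 : ℝ)).add hM).add hQ).const_mul (6 ^ κ))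
    ((hm.const_add 1).pow_const κ).aestronglyMeasurable (ae_of_all _ fun p => ?_)
  have h1 := affineScale_pos p
  rw [Real.norm_of_nonneg (by positivity)]
  simp only [Pi.add_apply]
  set x := max 1 (max |p.1| |p.2|) with hx
  have hx0 : 0 ≤ x := zero_le_one.trans (le_max_left _ _)
  have h2 : 1 + affineScale p ≤ 6 * x := by
    have a1 : 1 ≤ x := le_max_left _ _
    have a2 : |p.1| ≤ x := (le_max_left _ _).trans (le_max_right _ _)
    have a3 : |p.2| ≤ x := (le_max_right _ _).trans (le_max_right _ _)
    unfold affineScale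
    linarith
  have h3 : x ^ κ ≤ 1 + |p.1| ^ κ + |p.2| ^ κ := by
    have b1 : 0 ≤ |p.1| ^ κ := by positivity
    have b2 : 0 ≤ |p.2| ^ κ := by positivity
    rcases max_choice 1 (max |p.1| |p.2|) with h | h
    · rw [hx, h, Real.one_rpow]; linarith
    · rw [hx, h]
      rcases max_choice |p.1| |p.2| with h | h <;> rw [h] <;> linarith
  calc (1 + affineScale p) ^ κ ≤ (6 * x) ^ κ := Real.rpow_le_rpow (by positivity) h2 hκ.le
    _ = 6 ^ κ * x ^ κ := Real.mul_rpow (by norm_num) hx0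
    _ ≤ _ := by gcongr

theorem mul_log_le {a b : ℝ} (ha : 0 ≤ a) (hb : 0 < b) :
    a * Real.log b ≤ a * Real.log a + b := by
  rcases ha.eq_or_lt with rfl | ha
  · simp [hb.le]
  · have h := Real.log_le_sub_one_of_pos (div_pos hb ha)
    rw [Real.log_div hb.ne' ha.ne'] at h
    have h2 := mul_le_mul_of_nonneg_left h ha.le
    have h3 : a * (b / a - 1) = b - a := by field_simp
    rw [h3] at h2
    linarith

theorem integrable_rpow_mul_log_affineScale {ν : Measure (ℝ × ℝ)} [IsProbabilityMeasure ν] {κ : ℝ}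
    (hIRT : SatisfiesIRT ν (fun p => p.1) κ)
    (hQ : Integrable (fun p : ℝ × ℝ => |p.2| ^ κ) ν) :
    Integrable (fun p => |p.1| ^ κ * Real.log (1 + affineScale p)) ν := by
  have hκ := hIRT.1
  have hm := measurable_affineScale
  have hL := integrable_rpow_abs_mul_log measurable_fst hIRT
  have hS := integrable_rpow_affineScale hκ hIRT.integrable hQ
  refine Integrable.mono' (hL.add (hS.div_const κ))
    ((measurable_fst.abs.pow_const κ).mul (hm.const_add 1).log).aestronglyMeasurable
    (ae_of_all _ fun p => ?_)
  have h1 := affineScale_pos p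
  have hlog : 0 ≤ Real.log (1 + affineScale p) := Real.log_nonneg (by linarith)
  have hw : 0 ≤ |p.1| ^ κ := by positivity
  rw [Real.norm_of_nonneg (mul_nonneg hw hlog)]
  simp only [Pi.add_apply]
  have hy := mul_log_le hw (Real.rpow_pos_of_pos (by linarith : 0 < 1 + affineScale p) κ)
  rw [Real.log_rpow (by linarith)] at hy
  have hl : |p.1| ^ κ * Real.log (|p.1| ^ κ) = κ * (|p.1| ^ κ * Real.log |p.1|) := by
    rcases (abs_nonneg p.1).eq_or_lt with h0 | h0
    · simp [← h0, Real.zero_rpow hκ.ne']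
    · rw [Real.log_rpow h0]; ring
  rw [hl] at hy
  have : |p.1| ^ κ * Real.log (1 + affineScale p) * κ ≤
      (|p.1| ^ κ * Real.log |p.1| + (1 + affineScale p) ^ κ / κ) * κ := by
    rw [add_mul, div_mul_cancel₀ _ hκ.ne']
    linarith
  exact le_of_mul_le_mul_right this hκ

/-- The convex corrector in the subharmonic function
`t ↦ t ^ (-κ) * (1 + C * tailCorrector ν κ t)`. -/
def tailCorrector (ν : Measure (ℝ × ℝ)) (κ t : ℝ) : ℝ :=
  ∫ p, |p.1| ^ κ * Real.log (1 + affineScale p / t) ∂ν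

/-- The logarithmic slope of `tailCorrector`. -/
def tailSlope (ν : Measure (ℝ × ℝ)) (κ t : ℝ) : ℝ :=
  ∫ p, |p.1| ^ κ * (affineScale p / (t + affineScale p)) ∂ν

theorem norm_rpow_mul_log_affineScale_le (κ : ℝ) {t : ℝ} (ht : 1 ≤ t) (p : ℝ × ℝ) :
    ‖|p.1| ^ κ * Real.log (1 + affineScale p / t)‖ ≤
      |p.1| ^ κ * Real.log (1 + affineScale p) := by
  have h1 := affineScale_pos p
  have hd : 0 < affineScale p / t := by positivity
  have hlog : 0 ≤ Real.log (1 + affineScale p / t) := Real.log_nonneg (by linarith)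
  rw [Real.norm_of_nonneg (by positivity)]
  gcongr
  exact div_le_self h1.le ht

theorem measurable_rpow_mul_log_affineScale (κ t : ℝ) :
    Measurable fun p : ℝ × ℝ => |p.1| ^ κ * Real.log (1 + affineScale p / t) :=
  (measurable_fst.abs.pow_const κ).mul ((measurable_affineScale.div_const t).const_add 1).log

theorem integrable_tailCorrector {ν : Measure (ℝ × ℝ)} [IsProbabilityMeasure ν] {κ : ℝ}
    (hIRT : SatisfiesIRT ν (fun p => p.1) κ) (hQ : Integrable (fun p : ℝ × ℝ => |p.2| ^ κ) ν)
    {t : ℝ} (ht : 1 ≤ t) :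
    Integrable (fun p : ℝ × ℝ => |p.1| ^ κ * Real.log (1 + affineScale p / t)) ν :=
  Integrable.mono' (integrable_rpow_mul_log_affineScale hIRT hQ)
    (measurable_rpow_mul_log_affineScale κ t).aestronglyMeasurable
    (ae_of_all _ (norm_rpow_mul_log_affineScale_le κ ht))

theorem tailCorrector_nonneg (ν : Measure (ℝ × ℝ)) (κ : ℝ) {t : ℝ} (ht : 0 < t) :
    0 ≤ tailCorrector ν κ t := by
  refine integral_nonneg fun p => ?_
  have h1 : 0 < affineScale p / t := div_pos (affineScale_pos p) ht
  have hlog : 0 ≤ Real.log (1 + affineScale p / t) := Real.log_nonneg (by linarith)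
  positivity

theorem tailCorrector_le_one {ν : Measure (ℝ × ℝ)} [IsProbabilityMeasure ν] {κ : ℝ}
    (hIRT : SatisfiesIRT ν (fun p => p.1) κ) (hQ : Integrable (fun p : ℝ × ℝ => |p.2| ^ κ) ν)
    {t : ℝ} (ht : 1 ≤ t) : tailCorrector ν κ t ≤ tailCorrector ν κ 1 := by
  refine integral_mono (integrable_tailCorrector hIRT hQ ht)
    (integrable_tailCorrector hIRT hQ le_rfl) fun p => ?_
  have := norm_rpow_mul_log_affineScale_le κ ht p
  rw [div_one]
  exact (le_abs_self _).trans this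

theorem measurable_tailCorrector (ν : Measure (ℝ × ℝ)) [SFinite ν] (κ : ℝ) :
    Measurable (tailCorrector ν κ) := by
  have h : Measurable fun q : ℝ × (ℝ × ℝ) =>
      |q.2.1| ^ κ * Real.log (1 + affineScale q.2 / q.1) :=
    (measurable_snd.fst.abs.pow_const κ).mul
      (((measurable_affineScale.comp measurable_snd).div measurable_fst).const_add 1).log
  exact h.stronglyMeasurable.integral_prod_right.measurable

theorem tendsto_tailCorrector {ν : Measure (ℝ × ℝ)} [IsProbabilityMeasure ν] {κ : ℝ}
    (hIRT : SatisfiesIRT ν (fun p => p.1) κ) (hQ : Integrable (fun p : ℝ × ℝ => |p.2| ^ κ) ν) :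
    Tendsto (tailCorrector ν κ) atTop (nhds 0) := by
  have h := tendsto_integral_filter_of_dominated_convergence (μ := ν) (l := atTop)
    (F := fun t p => |p.1| ^ κ * Real.log (1 + affineScale p / t)) (f := fun _ => 0)
    (fun p => |p.1| ^ κ * Real.log (1 + affineScale p))
    (Eventually.of_forall fun t => (measurable_rpow_mul_log_affineScale κ t).aestronglyMeasurable)
    ((eventually_ge_atTop 1).mono fun t ht =>
      ae_of_all _ (norm_rpow_mul_log_affineScale_le κ ht))
    (integrable_rpow_mul_log_affineScale hIRT hQ)
    (ae_of_all _ fun p => by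
      have h1 : Tendsto (fun t : ℝ => 1 + affineScale p / t) atTop (nhds (1 + 0)) :=
        tendsto_const_nhds.add (tendsto_const_nhds.div_atTop tendsto_id)
      have h2 := (h1.log (by norm_num)).const_mul (|p.1| ^ κ)
      simpa using h2)
  rw [integral_zero] at h
  exact h

theorem integrable_tailSlope {ν : Measure (ℝ × ℝ)} {κ : ℝ}
    (hM : Integrable (fun p : ℝ × ℝ => |p.1| ^ κ) ν) {t : ℝ} (ht : 0 < t) :
    Integrable (fun p : ℝ × ℝ => |p.1| ^ κ * (affineScale p / (t + affineScale p))) ν := by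
  have hm := measurable_affineScale
  refine hM.mono' ((measurable_fst.abs.pow_const κ).mul
    (hm.div (hm.const_add t))).aestronglyMeasurable (ae_of_all _ fun p => ?_)
  have h1 := affineScale_pos p
  rw [Real.norm_of_nonneg (by positivity)]
  exact mul_le_of_le_one_right (by positivity) ((div_le_one (by positivity)).2 (by linarith))

theorem one_div_le_tailSlope {ν : Measure (ℝ × ℝ)} {κ : ℝ}
    (hIRT : SatisfiesIRT ν (fun p => p.1) κ) {t : ℝ} (ht : 0 < t) :
    1 / (t + 1) ≤ tailSlope ν κ t := by
  have h : 1 / (t + 1) = ∫ p : ℝ × ℝ, |p.1| ^ κ * (1 / (t + 1)) ∂ν := by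
    rw [integral_mul_const, hIRT.2.1, one_mul]
  rw [h]
  refine integral_mono (hIRT.integrable.mul_const _)
    (integrable_tailSlope hIRT.integrable ht) fun p => ?_
  have h1 := one_le_affineScale p
  refine mul_le_mul_of_nonneg_left ?_ (by positivity)
  rw [div_le_div_iff₀ (by positivity) (by positivity)]
  nlinarith

theorem tailCorrector_add_le {ν : Measure (ℝ × ℝ)} [IsProbabilityMeasure ν] {κ : ℝ}
    (hIRT : SatisfiesIRT ν (fun p => p.1) κ) (hQ : Integrable (fun p : ℝ × ℝ => |p.2| ^ κ) ν)
    {t t' : ℝ} (ht : 1 ≤ t) (ht' : 1 ≤ t') :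
    tailCorrector ν κ t + tailSlope ν κ t * Real.log (t / t') ≤ tailCorrector ν κ t' := by
  have h0 : 0 < t := by linarith
  have h0' : 0 < t' := by linarith
  have i1 := integrable_tailCorrector hIRT hQ ht
  have i2 := integrable_tailSlope hIRT.integrable h0
  unfold tailCorrector tailSlope
  rw [← integral_mul_const, ← integral_add i1 (i2.mul_const _)]
  refine integral_mono (i1.add (i2.mul_const _)) (integrable_tailCorrector hIRT hQ ht') fun p => ?_
  have := mul_le_mul_of_nonneg_left (log_one_add_div_ge (affineScale_pos p) h0 h0')
    (by positivity : 0 ≤ |p.1| ^ κ)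
  linarith

theorem tailSlope_le_tailCorrector {ν : Measure (ℝ × ℝ)} [IsProbabilityMeasure ν] {κ : ℝ}
    (hIRT : SatisfiesIRT ν (fun p => p.1) κ) (hQ : Integrable (fun p : ℝ × ℝ => |p.2| ^ κ) ν)
    {t : ℝ} (ht : 1 ≤ t) : tailSlope ν κ t ≤ tailCorrector ν κ t := by
  have h0 : 0 < t := by linarith
  refine integral_mono (integrable_tailSlope hIRT.integrable h0)
    (integrable_tailCorrector hIRT hQ ht) fun p => ?_
  have h1 := affineScale_pos p
  refine mul_le_mul_of_nonneg_left ?_ (by positivity)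
  have h2 := Real.one_sub_inv_le_log_of_pos (by positivity : 0 < 1 + affineScale p / t)
  refine le_trans (le_of_eq ?_) h2
  field_simp
  ring

/-- The drift of `log |M|` under the `κ`-tilted law, truncated to small perturbations. -/
def truncatedDrift (ν : Measure (ℝ × ℝ)) (κ t : ℝ) : ℝ :=
  ∫ p, {p : ℝ × ℝ | |p.1| ≤ t / 2 ∧ |p.2| ≤ t / 2}.indicator
    (fun p => (1 + |p.2| / t) ^ (-κ) * (|p.1| ^ κ * Real.log |p.1|)) p ∂ν

theorem measurableSet_small (t : ℝ) :
    MeasurableSet {p : ℝ × ℝ | |p.1| ≤ t / 2 ∧ |p.2| ≤ t / 2} :=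
  (measurableSet_le measurable_fst.abs measurable_const).inter
    (measurableSet_le measurable_snd.abs measurable_const)

theorem measurable_truncatedDrift (κ t : ℝ) :
    Measurable ({p : ℝ × ℝ | |p.1| ≤ t / 2 ∧ |p.2| ≤ t / 2}.indicator
      (fun p => (1 + |p.2| / t) ^ (-κ) * (|p.1| ^ κ * Real.log |p.1|))) :=
  ((((measurable_snd.abs.div_const t).const_add 1).pow_const (-κ)).mul
    ((measurable_fst.abs.pow_const κ).mul measurable_fst.abs.log)).indicator (measurableSet_small t)

theorem norm_truncatedDrift_le {κ t : ℝ} (hκ : 0 < κ) (ht : 0 < t) (p : ℝ × ℝ) :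
    ‖{p : ℝ × ℝ | |p.1| ≤ t / 2 ∧ |p.2| ≤ t / 2}.indicator
      (fun p => (1 + |p.2| / t) ^ (-κ) * (|p.1| ^ κ * Real.log |p.1|)) p‖ ≤
      ‖|p.1| ^ κ * Real.log |p.1|‖ := by
  refine (norm_indicator_le_norm_self _ _).trans ?_
  rw [norm_mul]
  refine mul_le_of_le_one_left (norm_nonneg _) ?_
  have : 0 ≤ |p.2| / t := by positivity
  rw [Real.norm_of_nonneg (by positivity)]
  exact Real.rpow_le_one_of_one_le_of_nonpos (by linarith) (by linarith)

theorem integrable_truncatedDrift {ν : Measure (ℝ × ℝ)} [IsProbabilityMeasure ν] {κ : ℝ}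
    (hIRT : SatisfiesIRT ν (fun p => p.1) κ) {t : ℝ} (ht : 0 < t) :
    Integrable ({p : ℝ × ℝ | |p.1| ≤ t / 2 ∧ |p.2| ≤ t / 2}.indicator
      (fun p => (1 + |p.2| / t) ^ (-κ) * (|p.1| ^ κ * Real.log |p.1|))) ν :=
  (integrable_rpow_abs_mul_log measurable_fst hIRT).norm.mono'
    (measurable_truncatedDrift κ t).aestronglyMeasurable
    (ae_of_all _ (norm_truncatedDrift_le hIRT.1 ht))

theorem tendsto_truncatedDrift {ν : Measure (ℝ × ℝ)} [IsProbabilityMeasure ν] {κ : ℝ}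
    (hIRT : SatisfiesIRT ν (fun p => p.1) κ) :
    Tendsto (truncatedDrift ν κ) atTop (nhds (∫ p, |p.1| ^ κ * Real.log |p.1| ∂ν)) := by
  refine tendsto_integral_filter_of_dominated_convergence
    (fun p : ℝ × ℝ => ‖|p.1| ^ κ * Real.log |p.1|‖)
    (Eventually.of_forall fun t => (measurable_truncatedDrift κ t).aestronglyMeasurable)
    ((eventually_gt_atTop 0).mono fun t ht => ae_of_all _ (norm_truncatedDrift_le hIRT.1 ht))
    (integrable_rpow_abs_mul_log measurable_fst hIRT).norm (ae_of_all _ fun p => ?_)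
  have h1 : Tendsto (fun t : ℝ => 1 + |p.2| / t) atTop (nhds (1 + 0)) :=
    tendsto_const_nhds.add (tendsto_const_nhds.div_atTop tendsto_id)
  have h2 := (h1.rpow_const (p := -κ) (Or.inl (by norm_num))).mul_const
    (|p.1| ^ κ * Real.log |p.1|)
  rw [add_zero, Real.one_rpow, one_mul] at h2
  refine h2.congr' ?_
  filter_upwards [eventually_ge_atTop (2 * |p.1|), eventually_ge_atTop (2 * |p.2|)] with t ha hb
  rw [indicator_of_mem]
  exact ⟨by linarith, by linarith⟩

/-- A bounded function of order `t ^ (-κ)` at infinity, subharmonic for the affine recursion. -/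
def tailMinorant (ν : Measure (ℝ × ℝ)) (κ C t : ℝ) : ℝ :=
  (Ici 1).indicator (fun t => t ^ (-κ) * (1 + C * tailCorrector ν κ t)) t

theorem measurable_tailMinorant (ν : Measure (ℝ × ℝ)) [SFinite ν] (κ C : ℝ) :
    Measurable (tailMinorant ν κ C) :=
  ((measurable_id.pow_const (-κ)).mul
    (((measurable_tailCorrector ν κ).const_mul C).const_add 1)).indicator measurableSet_Ici

theorem tailMinorant_nonneg (ν : Measure (ℝ × ℝ)) (κ : ℝ) {C : ℝ} (hC : 0 ≤ C) (t : ℝ) :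
    0 ≤ tailMinorant ν κ C t := by
  refine indicator_nonneg (fun t ht => ?_) t
  have ht : (0 : ℝ) < t := one_pos.trans_le ht
  have := tailCorrector_nonneg ν κ ht
  positivity

theorem tailMinorant_le {ν : Measure (ℝ × ℝ)} [IsProbabilityMeasure ν] {κ C : ℝ}
    (hIRT : SatisfiesIRT ν (fun p => p.1) κ) (hQ : Integrable (fun p : ℝ × ℝ => |p.2| ^ κ) ν)
    (hC : 0 ≤ C) {t : ℝ} (ht : 1 ≤ t) :
    tailMinorant ν κ C t ≤ t ^ (-κ) * (1 + C * tailCorrector ν κ 1) := by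
  have h0 : 0 < t := by linarith
  rw [tailMinorant, indicator_of_mem (mem_Ici.2 ht)]
  have := tailCorrector_le_one hIRT hQ ht
  gcongr

theorem tailMinorant_le_const {ν : Measure (ℝ × ℝ)} [IsProbabilityMeasure ν] {κ C : ℝ}
    (hIRT : SatisfiesIRT ν (fun p => p.1) κ) (hQ : Integrable (fun p : ℝ × ℝ => |p.2| ^ κ) ν)
    (hC : 0 ≤ C) (t : ℝ) :
    tailMinorant ν κ C t ≤ 1 + C * tailCorrector ν κ 1 := by
  have h1 := tailCorrector_nonneg ν κ one_pos
  rcases le_or_gt 1 t with ht | ht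
  · refine (tailMinorant_le hIRT hQ hC ht).trans ?_
    refine mul_le_of_le_one_left (by positivity) ?_
    exact Real.rpow_le_one_of_one_le_of_nonpos ht (by linarith [hIRT.1])
  · rw [tailMinorant, indicator_of_notMem (by simpa using ht)]
    positivity

theorem integrable_tailMinorant_comp {ν : Measure (ℝ × ℝ)} [IsProbabilityMeasure ν] {κ C : ℝ}
    (hIRT : SatisfiesIRT ν (fun p => p.1) κ) (hQ : Integrable (fun p : ℝ × ℝ => |p.2| ^ κ) ν)
    (hC : 0 ≤ C) (t : ℝ) :
    Integrable (fun p : ℝ × ℝ => tailMinorant ν κ C ((t - p.2) / p.1)) ν :=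
  Integrable.of_bound ((measurable_tailMinorant ν κ C).comp
    (by fun_prop : Measurable fun p : ℝ × ℝ => (t - p.2) / p.1)).aestronglyMeasurable
    (1 + C * tailCorrector ν κ 1) (ae_of_all _ fun p => by
      rw [Real.norm_of_nonneg (tailMinorant_nonneg ν κ hC _)]
      exact tailMinorant_le_const hIRT hQ hC _)

theorem tailMinorant_comp_ge {ν : Measure (ℝ × ℝ)} [IsProbabilityMeasure ν] {κ C t : ℝ}
    (hIRT : SatisfiesIRT ν (fun p => p.1) κ) (hQ : Integrable (fun p : ℝ × ℝ => |p.2| ^ κ) ν)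
    (hC : 0 ≤ C) (ht : 1 ≤ t) (hCt : C * tailCorrector ν κ t ≤ 1) {p : ℝ × ℝ} (hp : 0 < p.1) :
    t ^ (-κ) * (|p.1| ^ κ * (1 + C * tailCorrector ν κ t) -
      (4 + 2 * κ) * (|p.1| ^ κ * (affineScale p / (t + affineScale p))) +
      C * tailSlope ν κ t * {p : ℝ × ℝ | |p.1| ≤ t / 2 ∧ |p.2| ≤ t / 2}.indicator
        (fun p => (1 + |p.2| / t) ^ (-κ) * (|p.1| ^ κ * Real.log |p.1|)) p) ≤
      tailMinorant ν κ C ((t - p.2) / p.1) := by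
  have h0 : 0 < t := by linarith
  have hκ := hIRT.1
  have hΛ := affineScale_pos p
  have hW : 0 < |p.1| ^ κ := Real.rpow_pos_of_pos (abs_pos.2 hp.ne') κ
  have hT : 0 < t ^ (-κ) := Real.rpow_pos_of_pos h0 _
  have hρ := tailCorrector_nonneg ν κ h0
  have hCe : C * tailSlope ν κ t ≤ 1 :=
    (mul_le_mul_of_nonneg_left (tailSlope_le_tailCorrector hIRT hQ ht) hC).trans hCt
  have he : 0 ≤ tailSlope ν κ t := by
    refine le_trans ?_ (one_div_le_tailSlope hIRT h0)
    positivity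
  have hCρ := mul_nonneg hC hρ
  have hCe0 := mul_nonneg hC he
  set A := 1 + C * tailCorrector ν κ t with hA
  set E := C * tailSlope ν κ t with hE
  set lam := affineScale p / (t + affineScale p) with hlam
  have hlam0 : 0 ≤ lam := by positivity
  by_cases hG : |p.1| ≤ t / 2 ∧ |p.2| ≤ t / 2
  · rw [indicator_of_mem (show p ∈ {p : ℝ × ℝ | |p.1| ≤ t / 2 ∧ |p.2| ≤ t / 2} from hG)]
    obtain ⟨hG1, hG2⟩ := hG
    rw [abs_of_pos hp] at hG1
    have hq1 := neg_abs_le p.2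
    have hq2 := le_abs_self p.2
    set z := |p.2| / t with hz
    have hz0 : 0 ≤ z := by positivity
    have hzt : z * t = |p.2| := div_mul_cancel₀ _ h0.ne'
    have hzlam : z ≤ lam := by
      rw [hz, hlam, div_le_div_iff₀ h0 (by positivity)]
      have hs : 2 * |p.2| ≤ affineScale p := by
        unfold affineScale
        linarith [abs_nonneg p.1]
      nlinarith
    set t' := (t - p.2) / p.1 with ht'
    have ht'1 : 1 ≤ t' := by
      rw [ht', le_div_iff₀ hp]
      linarith
    have hr : 0 < 1 + z := by positivity
    have hle : t' ≤ t * (1 + z) / p.1 := by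
      rw [ht']
      gcongr
      linarith
    have ht'0 : 0 < t' := by linarith
    have hlogz : Real.log (1 + z) ≤ z := by
      have := Real.log_le_sub_one_of_pos hr
      linarith
    have hlog : Real.log p.1 - z ≤ Real.log (t / t') := by
      have h1 : Real.log t' ≤ Real.log (t * (1 + z) / p.1) := Real.log_le_log ht'0 hle
      have h2 : Real.log (t * (1 + z) / p.1) = Real.log t + Real.log (1 + z) - Real.log p.1 := by
        rw [Real.log_div (by positivity) hp.ne', Real.log_mul h0.ne' hr.ne']
      rw [h2] at h1
      rw [Real.log_div h0.ne' ht'0.ne']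
      linarith
    have hA' : A + E * (Real.log p.1 - z) ≤ 1 + C * tailCorrector ν κ t' := by
      have h1 := mul_le_mul_of_nonneg_left (tailCorrector_add_le hIRT hQ ht ht'1) hC
      have h2 := mul_le_mul_of_nonneg_left hlog hCe0
      rw [mul_add, ← mul_assoc] at h1
      linarith
    have hpow : t ^ (-κ) * (|p.1| ^ κ * (1 + z) ^ (-κ)) ≤ t' ^ (-κ) := by
      have h1 := Real.rpow_le_rpow_of_nonpos ht'0 hle (neg_nonpos.2 hκ.le)
      refine le_trans (le_of_eq ?_) h1
      rw [Real.div_rpow (by positivity) hp.le, Real.mul_rpow h0.le hr.le, Real.rpow_neg hp.le,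
        div_inv_eq_mul, abs_of_pos hp]
      ring
    have hbern : 1 - κ * z ≤ (1 + z) ^ (-κ) := by
      have h1 := Real.add_one_le_exp (-κ * Real.log (1 + z))
      rw [Real.rpow_def_of_pos hr, mul_comm (Real.log _)]
      nlinarith
    have hmain : A - (4 + 2 * κ) * lam + E * ((1 + z) ^ (-κ) * Real.log p.1) ≤
        (1 + z) ^ (-κ) * (1 + C * tailCorrector ν κ t') := by
      have hz1 : z ≤ 1 := by
        rw [hz, div_le_one h0]
        linarith
      have h1 : 0 ≤ A - E * z := by nlinarith
      have h2 := mul_le_mul_of_nonneg_right hbern h1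
      have h3 := mul_le_mul_of_nonneg_left hA' (by positivity : 0 ≤ (1 + z) ^ (-κ))
      have h4 : A - (4 + 2 * κ) * lam ≤ (1 - κ * z) * (A - E * z) := by
        have b1 : E * z ≤ z := mul_le_of_le_one_left hz0 hCe
        have b2 : κ * z * A ≤ κ * z * 2 :=
          mul_le_mul_of_nonneg_left (by linarith) (by positivity)
        have b3 : 0 ≤ κ * z * (E * z) := by positivity
        have b4 : κ * z ≤ κ * lam := mul_le_mul_of_nonneg_left hzlam hκ.le
        nlinarith
      linarith
    rw [tailMinorant, indicator_of_mem (mem_Ici.2 ht'1)]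
    have hpos' : 0 ≤ 1 + C * tailCorrector ν κ t' := by
      have := tailCorrector_nonneg ν κ ht'0
      positivity
    have := mul_le_mul_of_nonneg_right hpow hpos'
    refine le_trans ?_ this
    have h5 := mul_le_mul_of_nonneg_left hmain (mul_nonneg hT.le hW.le)
    rw [abs_of_pos hp] at h5 ⊢
    linarith
  · rw [indicator_of_notMem (show p ∉ {p : ℝ × ℝ | |p.1| ≤ t / 2 ∧ |p.2| ≤ t / 2} from hG),
      mul_zero, add_zero]
    refine le_trans ?_ (tailMinorant_nonneg ν κ hC _)
    have hs : t ≤ affineScale p := by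
      unfold affineScale
      have a1 := abs_nonneg p.1
      have a2 := abs_nonneg p.2
      rw [not_and_or, not_le, not_le] at hG
      rcases hG with h | h <;> linarith
    have hl : 1 / 2 ≤ lam := by
      rw [hlam, div_le_div_iff₀ two_pos (by positivity)]
      linarith
    have : A - (4 + 2 * κ) * lam ≤ 0 := by nlinarith
    have h2 := mul_nonpos_of_nonneg_of_nonpos (mul_nonneg hT.le hW.le) this
    linarith

theorem tailMinorant_add_le_integral {ν : Measure (ℝ × ℝ)} [IsProbabilityMeasure ν] {κ C t : ℝ}
    (hIRT : SatisfiesIRT ν (fun p => p.1) κ) (hQ : Integrable (fun p : ℝ × ℝ => |p.2| ^ κ) ν)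
    (hMpos : ∀ᵐ p ∂ν, 0 < p.1)
    (hC : 0 ≤ C) (ht : 1 ≤ t) (hCt : C * tailCorrector ν κ t ≤ 1)
    (hdrift : 5 + 2 * κ ≤ C * truncatedDrift ν κ t) :
    tailMinorant ν κ C t + t ^ (-κ) * (1 / (t + 1)) ≤
      ∫ p, tailMinorant ν κ C ((t - p.2) / p.1) ∂ν := by
  have h0 : 0 < t := by linarith
  have hT : 0 < t ^ (-κ) := Real.rpow_pos_of_pos h0 _
  have i1 := hIRT.integrable.mul_const (1 + C * tailCorrector ν κ t)
  have i2 := (integrable_tailSlope hIRT.integrable h0).const_mul (4 + 2 * κ)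
  have i3 := (integrable_truncatedDrift hIRT h0).const_mul (C * tailSlope ν κ t)
  have i4 := integrable_tailMinorant_comp hIRT hQ hC t
  have h := integral_mono_ae (((i1.sub i2).add i3).const_mul (t ^ (-κ))) i4
    (hMpos.mono fun p hp => tailMinorant_comp_ge hIRT hQ hC ht hCt hp)
  refine le_trans ?_ h
  have h_int := integral_add' (i1.sub i2) i3
  rw [integral_sub' i1 i2, integral_mul_const, integral_const_mul, integral_const_mul,
    hIRT.2.1, one_mul] at h_int
  rw [integral_const_mul]
  refine le_trans ?_ (mul_le_mul_of_nonneg_left h_int.ge hT.le)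
  rw [tailMinorant, indicator_of_mem (mem_Ici.2 ht), ← mul_add]
  refine mul_le_mul_of_nonneg_left ?_ hT.le
  have he := one_div_le_tailSlope hIRT h0
  have he0 : 0 ≤ tailSlope ν κ t := le_trans (by positivity) he
  have h1 := mul_le_mul_of_nonneg_left hdrift he0
  change _ ≤ _ - (4 + 2 * κ) * tailSlope ν κ t +
    C * tailSlope ν κ t * truncatedDrift ν κ t
  linarith

/-- Minimum principle: a function which is positive below some level, vanishes at infinity, and is
strictly superharmonic above that level is nonnegative. -/
theorem nonneg_of_strictly_superharmonic {α : Type*} [MeasurableSpace α] {ν : Measure α}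
    [IsProbabilityMeasure ν] {w gap : ℝ → ℝ} {f : ℝ → α → ℝ} {t₀ : ℝ}
    (hbdd : BddBelow (range w)) (hlow : ∀ t ≤ t₀, 0 ≤ w t) (hlim : Tendsto w atTop (nhds 0))
    (hgap : ∀ K, ∃ g > 0, ∀ t ∈ Icc t₀ K, g ≤ gap t)
    (h_int : ∀ t, Integrable (fun p => w (f t p)) ν)
    (hsup : ∀ t ≥ t₀, (∫ p, w (f t p) ∂ν) + gap t ≤ w t) (t : ℝ) : 0 ≤ w t := by
  by_contra! hneg
  set a := sInf (range w) with ha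
  have hale : ∀ s, a ≤ w s := fun s => csInf_le hbdd (mem_range_self s)
  have ha0 : a < 0 := (hale t).trans_lt hneg
  obtain ⟨K, hK⟩ := eventually_atTop.1 (hlim.eventually (lt_mem_nhds (by linarith : a / 2 < 0)))
  obtain ⟨g, hg, hgle⟩ := hgap K
  have hmin : ∀ s, min (a / 2) (a + g) ≤ w s := by
    intro s
    rcases le_total s t₀ with hs | hs
    · exact (min_le_left _ _).trans (by linarith [hlow s hs])
    · rcases le_total K s with hKs | hKs
      · exact (min_le_left _ _).trans (hK s hKs).le
      · refine (min_le_right _ _).trans ?_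
        have h1 : a ≤ ∫ p, w (f s p) ∂ν := by
          have := integral_mono (integrable_const a) (h_int s) fun p => hale (f s p)
          simpa using this
        linarith [hsup s hs, hgle s ⟨hs, hKs⟩]
  have := le_csInf (range_nonempty w) (forall_mem_range.2 hmin)
  rw [← ha] at this
  have h2 : a < min (a / 2) (a + g) := lt_min (by linarith) (by linarith)
  linarith

theorem exists_rpow_le_tail {ν : Measure (ℝ × ℝ)} [IsProbabilityMeasure ν] {κ : ℝ}
    (hIRT : SatisfiesIRT ν (fun p => p.1) κ) (hQ : Integrable (fun p : ℝ × ℝ => |p.2| ^ κ) ν)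
    (hMpos : ∀ᵐ p ∂ν, 0 < p.1) {η : Measure ℝ} [IsProbabilityMeasure η]
    (hfix : Measure.map (fun q : ℝ × (ℝ × ℝ) => q.2.1 * q.1 + q.2.2) (η.prod ν) = η)
    (hpos : ∀ t : ℝ, 0 < η.real (Ioi t)) :
    ∃ ε > 0, ∀ t : ℝ, 1 ≤ t → ε * t ^ (-κ) ≤ η.real (Ioi t) := by
  have hκ := hIRT.1
  have hm := hIRT.integral_rpow_mul_log_pos measurable_fst
  set m := ∫ p : ℝ × ℝ, |p.1| ^ κ * Real.log |p.1| ∂ν with hmdef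
  set C := 2 * (5 + 2 * κ) / m with hCdef
  have hC : 0 < C := by positivity
  have hev : ∀ᶠ t in atTop, 1 ≤ t ∧ C * tailCorrector ν κ t < 1 ∧ m / 2 < truncatedDrift ν κ t := by
    have h1 := (tendsto_tailCorrector hIRT hQ).const_mul C
    rw [mul_zero] at h1
    exact (eventually_ge_atTop 1).and ((h1.eventually (gt_mem_nhds one_pos)).and
      ((tendsto_truncatedDrift hIRT).eventually (lt_mem_nhds (by linarith))))
  obtain ⟨t₀, ht₀⟩ := eventually_atTop.1 hev
  have ht₀1 : 1 ≤ t₀ := (ht₀ t₀ le_rfl).1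
  set v := tailMinorant ν κ C with hv
  set B := 1 + C * tailCorrector ν κ 1 with hB
  have hB0 : 0 < B := by
    have := tailCorrector_nonneg ν κ one_pos
    positivity
  have hv0 := tailMinorant_nonneg ν κ hC.le
  have hvB := tailMinorant_le_const hIRT hQ hC.le
  set ε := η.real (Ioi t₀) / B with hε
  have hε0 : 0 < ε := div_pos (hpos t₀) hB0
  have hεB : ε * B = η.real (Ioi t₀) := div_mul_cancel₀ _ hB0.ne'
  have iF : ∀ t : ℝ, Integrable (fun p : ℝ × ℝ => η.real (Ioi ((t - p.2) / p.1))) ν :=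
    fun t => integrable_tail_comp ν η (by fun_prop)
  have iv : ∀ t : ℝ, Integrable (fun p : ℝ × ℝ => ε * v ((t - p.2) / p.1)) ν := fun t =>
    (integrable_tailMinorant_comp hIRT hQ hC.le t).const_mul ε
  have hvlim : Tendsto v atTop (nhds 0) := by
    have h1 := (tendsto_rpow_neg_atTop hκ).mul_const B
    rw [zero_mul] at h1
    exact squeeze_zero' (Eventually.of_forall hv0)
      ((eventually_ge_atTop 1).mono fun t ht => tailMinorant_le hIRT hQ hC.le ht) h1
  have hFlim : Tendsto (fun t : ℝ => η.real (Ioi t)) atTop (nhds 0) := by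
    have h1 := tendsto_measure_iInter_atTop (μ := η) (s := fun s : ℝ => Ioi s)
      (fun s => measurableSet_Ioi.nullMeasurableSet)
      (fun a b hab => Ioi_subset_Ioi hab) ⟨0, measure_ne_top _ _⟩
    have h2 : ⋂ s : ℝ, Ioi s = ∅ := by
      ext x
      simp only [mem_iInter, mem_Ioi, mem_empty_iff_false, iff_false, not_forall, not_lt]
      exact ⟨x, le_rfl⟩
    rw [h2, measure_empty] at h1
    exact (ENNReal.tendsto_toReal ENNReal.zero_ne_top).comp h1
  have hw := nonneg_of_strictly_superharmonic (ν := ν) (w := fun t => η.real (Ioi t) - ε * v t)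
    (gap := fun t => ε * (t ^ (-κ) * (1 / (t + 1)))) (f := fun t p => (t - p.2) / p.1) (t₀ := t₀)
    ⟨-(ε * B), by
      rintro _ ⟨s, rfl⟩
      have h1 := mul_le_mul_of_nonneg_left (hvB s) hε0.le
      have h2 : 0 ≤ η.real (Ioi s) := measureReal_nonneg
      linarith⟩
    (fun t ht => by
      have h1 := mul_le_mul_of_nonneg_left (hvB t) hε0.le
      have h2 := antitone_tail η ht
      simp only at h2
      linarith)
    (by simpa using hFlim.sub (hvlim.const_mul ε))
    (fun K => by
      set K' := max K t₀ with hK'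
      have hK0 : 0 < K' := by
        have := le_max_right K t₀
        linarith
      refine ⟨ε * (K' ^ (-κ) * (1 / (K' + 1))), by positivity, ?_⟩
      rintro s ⟨hs, hsK⟩
      have hs0 : 0 < s := by linarith
      have hsK' : s ≤ K' := hsK.trans (le_max_left _ _)
      have := Real.rpow_le_rpow_of_nonpos hs0 hsK' (neg_nonpos.2 hκ.le)
      gcongr)
    (fun t => (iF t).sub (iv t))
    (fun t ht => by
      obtain ⟨ht1, hCt, hdt⟩ := ht₀ t ht
      have hd : 5 + 2 * κ ≤ C * truncatedDrift ν κ t := by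
        have h1 := mul_le_mul_of_nonneg_left hdt.le hC.le
        have h2 : C * (m / 2) = 5 + 2 * κ := by
          rw [hCdef]
          field_simp
        linarith
      have h := mul_le_mul_of_nonneg_left
        (tailMinorant_add_le_integral hIRT hQ hMpos hC.le ht1 hCt.le hd) hε0.le
      rw [integral_sub (iF t) (iv t), ← tail_eq_integral hMpos hfix, integral_const_mul]
      linarith)
  refine ⟨ε, hε0, fun t ht => ?_⟩
  have h1 : t ^ (-κ) ≤ v t := by
    rw [hv, tailMinorant, indicator_of_mem (mem_Ici.2 ht)]
    have := tailCorrector_nonneg ν κ (one_pos.trans_le ht)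
    refine le_mul_of_one_le_right (Real.rpow_nonneg (by linarith) _) ?_
    linarith [mul_nonneg hC.le this]
  have h2 := mul_le_mul_of_nonneg_left h1 hε0.le
  linarith [hw t]

theorem exists_tail_le_rpow {η : Measure ℝ} [IsProbabilityMeasure η] {κ Cp : ℝ} (hκ : 0 < κ)
    (hCp : Tendsto (fun t : ℝ => t ^ κ * η.real (Ioi t)) atTop (nhds Cp)) (c : ℝ) :
    ∃ B : ℝ, ∀ t : ℝ, 0 < t → η.real (Ioi (c + t)) ≤ B * t ^ (-(κ / 2)) := by
  obtain ⟨K, hK⟩ := eventually_atTop.1 (hCp.eventually (gt_mem_nhds (lt_add_one Cp)))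
  set R := max (max K (2 * |c|)) 1 with hR
  have hR1 : 1 ≤ R := le_max_right _ _
  have hRK : K ≤ R := (le_max_left _ _).trans (le_max_left _ _)
  have hRc : 2 * |c| ≤ R := (le_max_right _ _).trans (le_max_left _ _)
  set D := max ((Cp + 1) * 2 ^ κ) 0 with hD
  have hD0 : 0 ≤ D := le_max_right _ _
  set R2 := 2 * R with hR2
  refine ⟨R2 ^ (κ / 2) + D, fun t ht => ?_⟩
  have hp : 0 < t ^ (-(κ / 2)) := Real.rpow_pos_of_pos ht _
  rcases le_total t R2 with h | h
  · have h1 : 1 ≤ R2 ^ (κ / 2) * t ^ (-(κ / 2)) := by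
      rw [Real.rpow_neg ht.le, ← div_eq_mul_inv, one_le_div (by positivity)]
      gcongr
    have h2 : η.real (Ioi (c + t)) ≤ 1 := measureReal_le_one
    nlinarith [mul_nonneg hD0 hp.le]
  · have hc := neg_abs_le c
    have hs : t / 2 ≤ c + t := by linarith
    have h3 := hK (t / 2) (by linarith)
    have h4 := antitone_tail η hs
    simp only at h4
    have h5 : η.real (Ioi (t / 2)) ≤ D * t ^ (-κ) := by
      rw [Real.rpow_neg ht.le, ← div_eq_mul_inv, le_div_iff₀ (by positivity)]
      refine le_trans ?_ (le_max_left _ _)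
      rw [Real.div_rpow ht.le zero_le_two] at h3
      have h6 : (0 : ℝ) < 2 ^ κ := by positivity
      have h7 := mul_le_mul_of_nonneg_right h3.le h6.le
      refine le_trans (le_of_eq ?_) h7
      field_simp
    have h8 : t ^ (-κ) ≤ t ^ (-(κ / 2)) :=
      Real.rpow_le_rpow_of_exponent_le (by linarith) (by linarith)
    have h9 := mul_le_mul_of_nonneg_left h8 hD0
    have h10 : 0 ≤ R2 ^ (κ / 2) * t ^ (-(κ / 2)) := by positivity
    linarith

/-- **Positivity of the Goldie constant (Guivarc'h–Le Page).** Let `(M,Q)` have law `ν`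
with `M > 0` a.s. satisfying (IRT-1)–(IRT-3), `E|Q|^κ < ∞`, `P(Mc+Q=c) < 1` for all `c`,
and let `η` be the (unique) solution of `X =_d MX + Q`.  Then
`C₊ = lim_{t→∞} t^κ P(X > t)` is positive iff `P(Mc + Q > c) > 0` for all `c ∈ ℝ`. -/
theorem perpetuity_tail_positive
    (ν : Measure (ℝ × ℝ)) [IsProbabilityMeasure ν]
    (κ : ℝ)
    (hIRT : SatisfiesIRT ν (fun p => p.1) κ)
    (hQ : Integrable (fun p : ℝ × ℝ => |p.2| ^ κ) ν)
    (hMpos : ∀ᵐ p ∂ν, 0 < p.1)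
    (hnodeg : ∀ c : ℝ, ν {p | p.1 * c + p.2 = c} < 1)
    (η : Measure ℝ) [IsProbabilityMeasure η]
    (hfix : Measure.map (fun q : ℝ × (ℝ × ℝ) => q.2.1 * q.1 + q.2.2) (η.prod ν) = η)
    (Cp : ℝ)
    (hCp : Tendsto (fun t : ℝ => t ^ κ * (η (Ioi t)).toReal) atTop (nhds Cp)) :
    0 < Cp ↔ ∀ c : ℝ, 0 < ν {p | c < p.1 * c + p.2} := by
  have hκ := hIRT.1
  constructor
  · intro h c
    by_contra hc
    have hc0 : ∀ᵐ p ∂ν, p.1 * c + p.2 ≤ c := by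
      rw [not_lt, nonpos_iff_eq_zero] at hc
      rw [ae_iff]
      simpa only [not_le] using hc
    obtain ⟨B, hB⟩ := exists_tail_le_rpow hκ hCp c
    have hzero : Tendsto (fun t : ℝ => t ^ κ * (η (Ioi t)).toReal) atTop (nhds 0) := by
      refine tendsto_const_nhds.congr' ((eventually_gt_atTop c).mono fun t ht => ?_)
      have := tail_eq_zero_of_invariant_halfLine hIRT hMpos hfix hc0 hB (sub_pos.2 ht)
      rw [add_sub_cancel, measureReal_def] at this
      simp only [this, mul_zero]
    exact h.ne' (tendsto_nhds_unique hCp hzero)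
  · intro h
    obtain ⟨ε, hε, hle⟩ := exists_rpow_le_tail hIRT hQ hMpos hfix (tail_pos hMpos hfix h)
    refine hε.trans_le (ge_of_tendsto hCp ((eventually_ge_atTop 1).mono fun t ht => ?_))
    have h0 : 0 < t := by linarith
    have h1 := mul_le_mul_of_nonneg_left (hle t ht) (Real.rpow_nonneg h0.le κ)
    refine le_trans (le_of_eq ?_) h1
    rw [Real.rpow_neg h0.le]
    have := (Real.rpow_pos_of_pos h0 κ).ne'
    field_simp
end
end

section
/- Let Ψ be a random Lipschitz map of (𝕏,d), x₀ ∈ 𝕏, and for r > 0 let M̲(r) = inf_{d(x₀,x)>r} d(x₀,Ψ(x))/d(x₀,x) and M̄(r) = sup_{d(x₀,x)>r} d(x₀,Ψ(x))/d(x₀,x), so that as r → ∞, M̲(r) ↑ M̲ := liminf_{d(x₀,x)→∞} d(x₀,Ψ(x))/d(x₀,x) and M̄(r) ↓ M̄ := limsup_{d(x₀,x)→∞} d(x₀,Ψ(x))/d(x₀,x). Suppose that for all sufficiently large r, M̲(r) and M̄(r) satisfy (IRT-1)–(IRT-3) with κ = α(r) and κ = β(r) respectively, that α := lim_{r→∞}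 α(r) equals β := lim_{r→∞} β(r), and that E M̄(s)^{α(s)} < ∞ for some s > 0. Then M̲ = M̄ =: M almost surely, and M satisfies E M^α = 1 and E M^α log⁺ M < ∞. -/
open MeasureTheory ProbabilityTheory Filter Set

noncomputable section

/-- `M̲(r) = inf_{d(x₀,x)>r} d(x₀,Ψ(x))/d(x₀,x)`. -/
def Mlo {𝕏 Θ : Type*} [MetricSpace 𝕏] (Ψ : Θ → 𝕏 → 𝕏) (x₀ : 𝕏) (r : ℝ) (p : Θ) : ℝ :=
  sInf {m : ℝ | ∃ y : 𝕏, r < dist x₀ y ∧ m = dist x₀ (Ψ p y) / dist x₀ y}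

/-- `M̄(r) = sup_{d(x₀,x)>r} d(x₀,Ψ(x))/d(x₀,x)`. -/
def Mhi {𝕏 Θ : Type*} [MetricSpace 𝕏] (Ψ : Θ → 𝕏 → 𝕏) (x₀ : 𝕏) (r : ℝ) (p : Θ) : ℝ :=
  sSup {m : ℝ | ∃ y : 𝕏, r < dist x₀ y ∧ m = dist x₀ (Ψ p y) / dist x₀ y}

/-- `M̲ = liminf_{d(x₀,x)→∞} d(x₀,Ψ(x))/d(x₀,x)` (the increasing limit of `M̲(r)`). -/
def MloLim {𝕏 Θ : Type*} [MetricSpace 𝕏] (Ψ : Θ → 𝕏 → 𝕏) (x₀ : 𝕏) (p : Θ) : ℝ :=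
  liminf (fun y : 𝕏 => dist x₀ (Ψ p y) / dist x₀ y)
    (Filter.comap (fun y : 𝕏 => dist x₀ y) atTop)

/-- `M̄ = limsup_{d(x₀,x)→∞} d(x₀,Ψ(x))/d(x₀,x)` (the decreasing limit of `M̄(r)`). -/
def MhiLim {𝕏 Θ : Type*} [MetricSpace 𝕏] (Ψ : Θ → 𝕏 → 𝕏) (x₀ : 𝕏) (p : Θ) : ℝ :=
  limsup (fun y : 𝕏 => dist x₀ (Ψ p y) / dist x₀ y)
    (Filter.comap (fun y : 𝕏 => dist x₀ y) atTop)

theorem comap_dist_atTop_neBot {𝕏 : Type*} [MetricSpace 𝕏] {x₀ : 𝕏}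
    (hunb : ∀ R : ℝ, ∃ x : 𝕏, R < dist x₀ x) :
    (Filter.comap (fun y : 𝕏 => dist x₀ y) atTop).NeBot := by
  rw [Filter.comap_neBot_iff]
  intro t ht
  obtain ⟨R, hR⟩ := mem_atTop_sets.1 ht
  obtain ⟨x, hx⟩ := hunb R
  exact ⟨x, hR _ hx.le⟩

theorem eventually_lt_dist {𝕏 : Type*} [MetricSpace 𝕏] (x₀ : 𝕏) (r : ℝ) :
    ∀ᶠ y in Filter.comap (fun y : 𝕏 => dist x₀ y) atTop, r < dist x₀ y :=
  tendsto_comap.eventually (eventually_gt_atTop r)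

theorem exists_of_eventually_comap_dist {𝕏 : Type*} [MetricSpace 𝕏] {x₀ : 𝕏} {P : 𝕏 → Prop}
    (h : ∀ᶠ y in Filter.comap (fun y : 𝕏 => dist x₀ y) atTop, P y) :
    ∃ R : ℝ, ∀ y, R ≤ dist x₀ y → P y := by
  obtain ⟨R, hR⟩ := eventually_atTop.1 (eventually_comap.1 h)
  exact ⟨R, fun y hy => hR _ hy y rfl⟩

section RatioBounds

variable {𝕏 Θ : Type*} [MetricSpace 𝕏] {Ψ : Θ → 𝕏 → 𝕏} {x₀ : 𝕏} {p : Θ}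

theorem bddBelow_ratio (r : ℝ) :
    BddBelow {m : ℝ | ∃ y : 𝕏, r < dist x₀ y ∧ m = dist x₀ (Ψ p y) / dist x₀ y} := by
  refine ⟨0, ?_⟩
  rintro m ⟨y, -, rfl⟩
  positivity

theorem bddAbove_ratio (hΨ : ∃ K : NNReal, LipschitzWith K (Ψ p)) {r : ℝ} (hr : 0 < r) :
    BddAbove {m : ℝ | ∃ y : 𝕏, r < dist x₀ y ∧ m = dist x₀ (Ψ p y) / dist x₀ y} := by
  obtain ⟨K, hK⟩ := hΨ
  refine ⟨dist x₀ (Ψ p x₀) / r + K, ?_⟩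
  rintro m ⟨y, hy, rfl⟩
  have hpos : 0 < dist x₀ y := hr.trans hy
  rw [div_le_iff₀ hpos, add_mul]
  have h1 := dist_triangle x₀ (Ψ p x₀) (Ψ p y)
  have h2 := hK.dist_le_mul x₀ y
  have h3 : dist x₀ (Ψ p x₀) ≤ dist x₀ (Ψ p x₀) / r * dist x₀ y := by
    rw [div_mul_eq_mul_div, le_div_iff₀ hr]
    exact mul_le_mul_of_nonneg_left hy.le dist_nonneg
  linarith

theorem nonempty_ratio (hunb : ∀ R : ℝ, ∃ x : 𝕏, R < dist x₀ x) (r : ℝ) :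
    {m : ℝ | ∃ y : 𝕏, r < dist x₀ y ∧ m = dist x₀ (Ψ p y) / dist x₀ y}.Nonempty := by
  obtain ⟨y, hy⟩ := hunb r
  exact ⟨_, y, hy, rfl⟩

theorem Mlo_nonneg (r : ℝ) : 0 ≤ Mlo Ψ x₀ r p := by
  refine Real.sInf_nonneg ?_
  rintro m ⟨y, -, rfl⟩
  positivity

theorem Mhi_nonneg (r : ℝ) : 0 ≤ Mhi Ψ x₀ r p := by
  refine Real.sSup_nonneg ?_
  rintro m ⟨y, -, rfl⟩
  positivity

theorem Mlo_le_ratio {r : ℝ} {y : 𝕏} (hy : r < dist x₀ y) :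
    Mlo Ψ x₀ r p ≤ dist x₀ (Ψ p y) / dist x₀ y :=
  csInf_le (bddBelow_ratio r) ⟨y, hy, rfl⟩

theorem ratio_le_Mhi (hΨ : ∃ K : NNReal, LipschitzWith K (Ψ p)) {r : ℝ} (hr : 0 < r) {y : 𝕏}
    (hy : r < dist x₀ y) : dist x₀ (Ψ p y) / dist x₀ y ≤ Mhi Ψ x₀ r p :=
  le_csSup (bddAbove_ratio hΨ hr) ⟨y, hy, rfl⟩

theorem Mlo_mono (hunb : ∀ R : ℝ, ∃ x : 𝕏, R < dist x₀ x) {r t : ℝ} (h : r ≤ t) :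
    Mlo Ψ x₀ r p ≤ Mlo Ψ x₀ t p :=
  csInf_le_csInf (bddBelow_ratio r) (nonempty_ratio hunb t)
    fun _ ⟨y, hy, hm⟩ => ⟨y, h.trans_lt hy, hm⟩

theorem Mhi_anti (hunb : ∀ R : ℝ, ∃ x : 𝕏, R < dist x₀ x)
    (hΨ : ∃ K : NNReal, LipschitzWith K (Ψ p)) {r t : ℝ} (hr : 0 < r) (h : r ≤ t) :
    Mhi Ψ x₀ t p ≤ Mhi Ψ x₀ r p :=
  csSup_le_csSup (bddAbove_ratio hΨ hr) (nonempty_ratio hunb t)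
    fun _ ⟨y, hy, hm⟩ => ⟨y, h.trans_lt hy, hm⟩

theorem Mlo_le_Mhi (hunb : ∀ R : ℝ, ∃ x : 𝕏, R < dist x₀ x)
    (hΨ : ∃ K : NNReal, LipschitzWith K (Ψ p)) {r : ℝ} (hr : 0 < r) :
    Mlo Ψ x₀ r p ≤ Mhi Ψ x₀ r p := by
  obtain ⟨y, hy⟩ := hunb r
  exact (Mlo_le_ratio hy).trans (ratio_le_Mhi hΨ hr hy)

theorem isBoundedUnder_le_ratio (hΨ : ∃ K : NNReal, LipschitzWith K (Ψ p)) :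
    (Filter.comap (fun y : 𝕏 => dist x₀ y) atTop).IsBoundedUnder (· ≤ ·)
      (fun y : 𝕏 => dist x₀ (Ψ p y) / dist x₀ y) :=
  isBoundedUnder_of_eventually_le
    ((eventually_lt_dist x₀ 1).mono fun _ hy => ratio_le_Mhi hΨ one_pos hy)

theorem isBoundedUnder_ge_ratio :
    (Filter.comap (fun y : 𝕏 => dist x₀ y) atTop).IsBoundedUnder (· ≥ ·)
      (fun y : 𝕏 => dist x₀ (Ψ p y) / dist x₀ y) :=
  isBoundedUnder_of_eventually_ge (a := 0) (Eventually.of_forall fun _ => by positivity)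

theorem Mlo_le_MloLim (hunb : ∀ R : ℝ, ∃ x : 𝕏, R < dist x₀ x)
    (hΨ : ∃ K : NNReal, LipschitzWith K (Ψ p)) (r : ℝ) : Mlo Ψ x₀ r p ≤ MloLim Ψ x₀ p := by
  have := comap_dist_atTop_neBot hunb
  exact le_liminf_of_le (isBoundedUnder_le_ratio hΨ).isCoboundedUnder_ge
    ((eventually_lt_dist x₀ r).mono fun _ hy => Mlo_le_ratio hy)

theorem MhiLim_le_Mhi (hunb : ∀ R : ℝ, ∃ x : 𝕏, R < dist x₀ x)
    (hΨ : ∃ K : NNReal, LipschitzWith K (Ψ p)) {r : ℝ} (hr : 0 < r) :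
    MhiLim Ψ x₀ p ≤ Mhi Ψ x₀ r p := by
  have := comap_dist_atTop_neBot hunb
  exact limsup_le_of_le isBoundedUnder_ge_ratio.isCoboundedUnder_le
    ((eventually_lt_dist x₀ r).mono fun _ hy => ratio_le_Mhi hΨ hr hy)

theorem MloLim_le_MhiLim (hunb : ∀ R : ℝ, ∃ x : 𝕏, R < dist x₀ x)
    (hΨ : ∃ K : NNReal, LipschitzWith K (Ψ p)) : MloLim Ψ x₀ p ≤ MhiLim Ψ x₀ p := by
  have := comap_dist_atTop_neBot hunb
  exact liminf_le_limsup (isBoundedUnder_le_ratio hΨ) isBoundedUnder_ge_ratio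

theorem tendsto_Mlo (hunb : ∀ R : ℝ, ∃ x : 𝕏, R < dist x₀ x)
    (hΨ : ∃ K : NNReal, LipschitzWith K (Ψ p)) :
    Tendsto (fun r => Mlo Ψ x₀ r p) atTop (nhds (MloLim Ψ x₀ p)) := by
  refine tendsto_order.2 ⟨fun b hb => ?_, fun b hb =>
    Eventually.of_forall fun r => (Mlo_le_MloLim hunb hΨ r).trans_lt hb⟩
  obtain ⟨c, hbc, hc⟩ := exists_between hb
  obtain ⟨R, hR⟩ := exists_of_eventually_comap_dist
    (eventually_lt_of_lt_liminf hc isBoundedUnder_ge_ratio)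
  filter_upwards [eventually_ge_atTop R] with r hr
  refine hbc.trans_le (le_csInf (nonempty_ratio hunb r) ?_)
  rintro m ⟨y, hy, rfl⟩
  exact (hR y (hr.trans hy.le)).le

theorem tendsto_Mhi (hunb : ∀ R : ℝ, ∃ x : 𝕏, R < dist x₀ x)
    (hΨ : ∃ K : NNReal, LipschitzWith K (Ψ p)) :
    Tendsto (fun r => Mhi Ψ x₀ r p) atTop (nhds (MhiLim Ψ x₀ p)) := by
  refine tendsto_order.2 ⟨fun b hb => (eventually_gt_atTop 0).mono fun r hr =>
    hb.trans_le (MhiLim_le_Mhi hunb hΨ hr), fun b hb => ?_⟩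
  obtain ⟨c, hc, hcb⟩ := exists_between hb
  obtain ⟨R, hR⟩ := exists_of_eventually_comap_dist
    (eventually_lt_of_limsup_lt hc (isBoundedUnder_le_ratio hΨ))
  filter_upwards [eventually_ge_atTop R] with r hr
  refine (csSup_le (nonempty_ratio hunb r) ?_).trans_lt hcb
  rintro m ⟨y, hy, rfl⟩
  exact (hR y (hr.trans hy.le)).le

end RatioBounds

section Exponents

variable {Θ : Type*} [MeasurableSpace Θ] {ν : Measure Θ} {M N : Θ → ℝ} {a b : ℝ}

theorem SatisfiesIRT.integral_rpow (h : SatisfiesIRT ν M a) (hM : ∀ p, 0 ≤ M p) :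
    ∫ p, M p ^ a ∂ν = 1 := by
  simpa only [abs_of_nonneg (hM _)] using h.2.1

theorem SatisfiesIRT.integrable_rpow (h : SatisfiesIRT ν M a) (hM : ∀ p, 0 ≤ M p) :
    Integrable (fun p => M p ^ a) ν :=
  Integrable.of_integral_ne_zero (by rw [h.integral_rpow hM]; exact one_ne_zero)

theorem SatisfiesIRT.aemeasurable (h : SatisfiesIRT ν M a) (hM : ∀ p, 0 ≤ M p) :
    AEMeasurable M ν := by
  refine ((h.integrable_rpow hM).aemeasurable.pow_const a⁻¹).congr (ae_of_all _ fun p => ?_)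
  exact Real.rpow_rpow_inv (hM p) h.1.ne'

/-- Raising a multiplier satisfying the renewal conditions lowers its exponent. -/
theorem SatisfiesIRT.exponent_le [IsProbabilityMeasure ν] (hM : SatisfiesIRT ν M a)
    (hN : SatisfiesIRT ν N b) (hM0 : ∀ p, 0 ≤ M p) (hMN : ∀ p, M p ≤ N p) : b ≤ a := by
  by_contra! hab
  have ha := hM.1
  have hN0 : ∀ p, 0 ≤ N p := fun p => (hM0 p).trans (hMN p)
  have hp : 1 < b / a := (one_lt_div ha).2 hab
  have hMi := hM.integrable_rpow hM0
  have hNi := hN.integrable_rpow hN0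
  have hpow : ∀ p, (1 + (N p ^ a - 1)) ^ (b / a) = N p ^ b := fun p => by
    rw [add_sub_cancel, ← Real.rpow_mul (hN0 p), mul_div_cancel₀ _ ha.ne']
  have hle : ∀ p, M p ^ a ≤ N p ^ a := fun p => Real.rpow_le_rpow (hM0 p) (hMN p) ha.le
  have hge : ∀ p, -1 ≤ N p ^ a - 1 := fun p => by
    have := Real.rpow_nonneg (hN0 p) a
    linarith
  have hmul : ∀ p, b / a * (M p ^ a - 1) ≤ b / a * (N p ^ a - 1) := fun p =>
    mul_le_mul_of_nonneg_left (sub_le_sub_right (hle p) 1) (by linarith)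
  set f : Θ → ℝ := fun p => (N p ^ b - 1) - b / a * (M p ^ a - 1) with hf
  have hi1 : Integrable (fun p => N p ^ b - 1) ν := hNi.sub (integrable_const 1)
  have hi2 : Integrable (fun p => b / a * (M p ^ a - 1)) ν :=
    (hMi.sub (integrable_const 1)).const_mul _
  have hf0 : 0 ≤ f := fun p => by
    have h1 := one_add_mul_self_le_rpow_one_add (hge p) hp.le
    rw [hpow] at h1
    have := hmul p
    simp only [hf, Pi.zero_apply]
    linarith
  have hfint : ∫ p, f p ∂ν = 0 := by
    rw [hf, integral_sub hi1 hi2, integral_const_mul, integral_sub hNi (integrable_const 1),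
      integral_sub hMi (integrable_const 1), hN.integral_rpow hN0, hM.integral_rpow hM0]
    simp
  have hae := (integral_eq_zero_iff_of_nonneg hf0 (hi1.sub hi2)).1 hfint
  refine (hN.2.2.2 0).ne' (measure_mono_null ?_ (ae_iff.1 hae))
  rintro p ⟨-, hlog⟩ hfp
  have hfp' : (N p ^ b - 1) - b / a * (M p ^ a - 1) = 0 := hfp
  have hne : N p ^ a - 1 ≠ 0 := fun h => by
    refine hlog 0 ?_
    have h1 : N p = 1 := by
      rw [← Real.rpow_rpow_inv (hN0 p) ha.ne', sub_eq_zero.1 h, Real.one_rpow]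
    simp [h1]
  have h1 := one_add_mul_self_lt_rpow_one_add (hge p) hne hp
  rw [hpow] at h1
  linarith [hmul p]

theorem ae_eq_of_integral_rpow_eq (ha : 0 < a) (hM0 : ∀ p, 0 ≤ M p) (hMN : ∀ p, M p ≤ N p)
    (hMi : Integrable (fun p => M p ^ a) ν) (hNi : Integrable (fun p => N p ^ a) ν)
    (h : ∫ p, M p ^ a ∂ν = ∫ p, N p ^ a ∂ν) : M =ᵐ[ν] N := by
  have hae := (integral_eq_iff_of_ae_le hMi hNi
    (ae_of_all _ fun p => Real.rpow_le_rpow (hM0 p) (hMN p) ha.le)).1 h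
  filter_upwards [hae] with p hp
  exact (Real.rpow_left_inj (hM0 p) ((hM0 p).trans (hMN p)) ha.ne').1 hp

theorem rpow_le_one_add_rpow {x y : ℝ} (hx : 0 ≤ x) (hxy : x ≤ y) (ha : 0 ≤ a) (hab : a ≤ b) :
    x ^ a ≤ 1 + y ^ b := by
  have hy := hx.trans hxy
  refine (Real.rpow_le_rpow hx hxy ha).trans ?_
  rcases le_total y 1 with h | h
  · have := Real.rpow_le_one hy h ha
    have := Real.rpow_nonneg hy b
    linarith
  · have := Real.rpow_le_rpow_of_exponent_le h hab
    linarith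

theorem rpow_mul_posLog_le {x y : ℝ} (hx : 0 ≤ x) (hxy : x ≤ y) (ha : 0 < a) (hab : a < b) :
    x ^ a * max (Real.log x) 0 ≤ y ^ b / (b - a) := by
  have hd : 0 < b - a := sub_pos.2 hab
  rcases hx.eq_or_lt with rfl | hx0
  · rw [Real.zero_rpow ha.ne', zero_mul]
    exact div_nonneg (Real.rpow_nonneg hxy b) hd.le
  have h1 : max (Real.log x) 0 ≤ x ^ (b - a) / (b - a) :=
    max_le (Real.log_le_rpow_div hx hd) (div_nonneg (Real.rpow_nonneg hx _) hd.le)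
  calc x ^ a * max (Real.log x) 0 ≤ x ^ a * (x ^ (b - a) / (b - a)) :=
        mul_le_mul_of_nonneg_left h1 (Real.rpow_nonneg hx _)
    _ = x ^ b / (b - a) := by
        rw [← mul_div_assoc, ← Real.rpow_add hx0, add_sub_cancel]
    _ ≤ y ^ b / (b - a) :=
        div_le_div_of_nonneg_right (Real.rpow_le_rpow hx hxy (ha.trans hab).le) hd.le

/-- Dominated convergence for powers with varying exponent. -/
theorem integrable_and_integral_rpow_eq_one_of_tendsto [IsProbabilityMeasure ν]
    {F : ℝ → Θ → ℝ} {L : Θ → ℝ} {κ : ℝ → ℝ} {s : ℝ}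
    (hF : ∀ r, s ≤ r → SatisfiesIRT ν (F r) (κ r)) (hF0 : ∀ r p, 0 ≤ F r p)
    (hFN : ∀ r, s ≤ r → ∀ p, F r p ≤ N p) (hκ : ∀ r, s ≤ r → κ r ≤ b) (ha : 0 < a)
    (hκa : Tendsto κ atTop (nhds a)) (hL : ∀ p, Tendsto (fun r => F r p) atTop (nhds (L p)))
    (hN : Integrable (fun p => N p ^ b) ν) :
    Integrable (fun p => L p ^ a) ν ∧ ∫ p, L p ^ a ∂ν = 1 := by
  have hlim : Tendsto (fun r => ∫ p, F r p ^ κ r ∂ν) atTop (nhds (∫ p, L p ^ a ∂ν)) := by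
    refine tendsto_integral_filter_of_dominated_convergence (fun p => 1 + N p ^ b) ?_ ?_
      ((integrable_const 1).add hN) ?_
    · filter_upwards [eventually_ge_atTop s] with r hr
      exact ((hF r hr).integrable_rpow (hF0 r)).aestronglyMeasurable
    · filter_upwards [eventually_ge_atTop s] with r hr
      refine ae_of_all _ fun p => ?_
      rw [Real.norm_of_nonneg (Real.rpow_nonneg (hF0 r p) _)]
      exact rpow_le_one_add_rpow (hF0 r p) (hFN r hr p) (hF r hr).1.le (hκ r hr)
    · exact ae_of_all _ fun p => (hL p).rpow hκa (Or.inr ha)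
  have h1 : ∫ p, L p ^ a ∂ν = 1 := by
    refine tendsto_nhds_unique hlim (tendsto_const_nhds.congr' ?_)
    filter_upwards [eventually_ge_atTop s] with r hr
    exact ((hF r hr).integral_rpow (hF0 r)).symm
  exact ⟨Integrable.of_integral_ne_zero (by rw [h1]; exact one_ne_zero), h1⟩

end Exponents

/-- **Identification of the limiting multiplier.** If, for all `r` beyond some `r₀`,
`M̲(r)` and `M̄(r)` satisfy (IRT-1)–(IRT-3) with exponents `α(r)` and `β(r)`
respectively, `α := lim α(r)` equals `β := lim β(r)`, and `E M̄(s)^{α(s)} < ∞` for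
some `s`, then `M̲ = M̄ =: M` almost surely and `M` satisfies (IRT-1) and (IRT-2) with
exponent `α`: `E M^α = 1` and `E M^α log⁺ M < ∞`. -/
theorem limiting_multiplier
    {𝕏 Θ : Type*} [MetricSpace 𝕏] [MeasurableSpace Θ]
    (x₀ : 𝕏) (hunb : ∀ R : ℝ, ∃ x : 𝕏, R < dist x₀ x)
    (ν : Measure Θ) [IsProbabilityMeasure ν]
    (Ψ : Θ → 𝕏 → 𝕏) (hΨlip : ∀ p, ∃ K : NNReal, LipschitzWith K (Ψ p))
    (r₀ : ℝ) (hr₀ : 0 < r₀) (af bf : ℝ → ℝ)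
    (hIRT : ∀ r : ℝ, r₀ ≤ r →
      SatisfiesIRT ν (Mlo Ψ x₀ r) (af r) ∧ SatisfiesIRT ν (Mhi Ψ x₀ r) (bf r))
    (α : ℝ) (haf : Tendsto af atTop (nhds α)) (hbf : Tendsto bf atTop (nhds α))
    (s : ℝ) (hs : r₀ ≤ s)
    (hMs : Integrable (fun p => Mhi Ψ x₀ s p ^ af s) ν) :
    (∀ᵐ p ∂ν, MloLim Ψ x₀ p = MhiLim Ψ x₀ p) ∧
    (∫ p, MhiLim Ψ x₀ p ^ α ∂ν) = 1 ∧
    Integrable (fun p => MhiLim Ψ x₀ p ^ α * max (Real.log (MhiLim Ψ x₀ p)) 0) ν := by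
  have hr₀s : ∀ r, s ≤ r → r₀ ≤ r := fun r hr => hs.trans hr
  have hs0 : 0 < s := hr₀.trans_le hs
  have hanti : ∀ r t, r₀ ≤ r → r ≤ t → af t ≤ af r := fun r t hr hrt =>
    (hIRT r hr).1.exponent_le (hIRT t (hr.trans hrt)).1 (fun _ => Mlo_nonneg r)
      fun _ => Mlo_mono hunb hrt
  have hmono : ∀ r t, r₀ ≤ r → r ≤ t → bf r ≤ bf t := fun r t hr hrt =>
    (hIRT t (hr.trans hrt)).2.exponent_le (hIRT r hr).2 (fun _ => Mhi_nonneg t)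
      fun p => Mhi_anti hunb (hΨlip p) (hr₀.trans_le hr) hrt
  have hα_le : ∀ r, r₀ ≤ r → α ≤ af r := fun r hr =>
    le_of_tendsto haf ((eventually_ge_atTop r).mono fun t ht => hanti r t hr ht)
  have hle_α : ∀ r, r₀ ≤ r → bf r ≤ α := fun r hr =>
    ge_of_tendsto hbf ((eventually_ge_atTop r).mono fun t ht => hmono r t hr ht)
  have hα : 0 < α := (hIRT s hs).2.1.trans_le (hle_α s hs)
  have hlo0 : ∀ p, 0 ≤ MloLim Ψ x₀ p := fun p =>
    (Mlo_nonneg s).trans (Mlo_le_MloLim hunb (hΨlip p) s)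
  have hlohi : ∀ p, MloLim Ψ x₀ p ≤ MhiLim Ψ x₀ p := fun p => MloLim_le_MhiLim hunb (hΨlip p)
  have hhi0 : ∀ p, 0 ≤ MhiLim Ψ x₀ p := fun p => (hlo0 p).trans (hlohi p)
  obtain ⟨hloi, hlo1⟩ := integrable_and_integral_rpow_eq_one_of_tendsto (F := Mlo Ψ x₀)
    (fun r hr => (hIRT r (hr₀s r hr)).1) (fun r _ => Mlo_nonneg r)
    (fun r hr p => (Mlo_le_Mhi hunb (hΨlip p) (hs0.trans_le hr)).trans
      (Mhi_anti hunb (hΨlip p) hs0 hr))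
    (fun r hr => hanti s r hs hr) hα haf (fun p => tendsto_Mlo hunb (hΨlip p)) hMs
  obtain ⟨hhii, hhi1⟩ := integrable_and_integral_rpow_eq_one_of_tendsto (F := Mhi Ψ x₀)
    (fun r hr => (hIRT r (hr₀s r hr)).2) (fun r _ => Mhi_nonneg r)
    (fun r hr p => Mhi_anti hunb (hΨlip p) hs0 hr)
    (fun r hr => (hle_α r (hr₀s r hr)).trans (hα_le s hs)) hα hbf
    (fun p => tendsto_Mhi hunb (hΨlip p)) hMs
  have heq := ae_eq_of_integral_rpow_eq hα hlo0 hlohi hloi hhii (hlo1.trans hhi1.symm)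
  refine ⟨heq, hhi1, ?_⟩
  rcases (hα_le s hs).lt_or_eq with hlt | hαs
  · have hmeas : AEMeasurable (MhiLim Ψ x₀) ν :=
      (hhii.aemeasurable.pow_const α⁻¹).congr
        (ae_of_all _ fun p => Real.rpow_rpow_inv (hhi0 p) hα.ne')
    refine (hMs.div_const (af s - α)).mono' (hhii.aestronglyMeasurable.mul
      (hmeas.log.max aemeasurable_const).aestronglyMeasurable) (ae_of_all _ fun p => ?_)
    rw [Real.norm_of_nonneg (mul_nonneg (Real.rpow_nonneg (hhi0 p) _) (le_max_right _ _))]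
    exact rpow_mul_posLog_le (hhi0 p) (MhiLim_le_Mhi hunb (hΨlip p) hs0) hα hlt
  · have hirt := (hIRT s hs).1
    rw [← hαs] at hirt
    have h0 : ∀ p, 0 ≤ Mlo Ψ x₀ s p := fun _ => Mlo_nonneg s
    have heq' := ae_eq_of_integral_rpow_eq hα h0
      (fun p => Mlo_le_MloLim hunb (hΨlip p) s) (hirt.integrable_rpow h0) hloi
      ((hirt.integral_rpow h0).trans hlo1.symm)
    refine hirt.2.2.1.congr ?_
    filter_upwards [heq, heq'] with p hp hp'
    rw [← hp, ← hp', abs_of_nonneg (h0 p)]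
end
end

section
/- Let (Xₙ)ₙ≥₀ be an IFS of iid Lipschitz maps Ψ, Ψ₁, Ψ₂, … on a complete separable metric space (𝕏,d) with unbounded d, with stationary law π and fixed x₀ ∈ 𝕏. Suppose there exist r ≥ 0 and nonnegative random variables M, R̲, R̄ (jointly distributed with Ψ) such that, almost surely for all x ∈ 𝕏, R̲ ∨ (M·d(x₀,x)·1_{(r,∞)}(d(x₀,x))) ≤ d(x₀,Ψ(x)) ≤ R̄ + M·d(x₀,x). If P(R̲ > r) > 0, P(R̄ > 0) > 0, E R̄^κ < ∞, and M satisfies (IRT-1)–(IRT-3) for κ > 0, then the law of d(x₀,X₀) under π has exact tail index κ. -/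
open MeasureTheory ProbabilityTheory Filter Set
open scoped ENNReal

noncomputable section

/-- `ρ` has exact tail index `κ`: `0 < liminf t^κ ρ(t,∞) ≤ limsup t^κ ρ(t,∞) < ∞`. -/
def ExactTailIndex (ρ : Measure ℝ) (κ : ℝ) : Prop :=
  0 < κ ∧
  0 < liminf (fun t : ℝ => ENNReal.ofReal (t ^ κ) * ρ (Ioi t)) atTop ∧
  limsup (fun t : ℝ => ENNReal.ofReal (t ^ κ) * ρ (Ioi t)) atTop < ⊤

/-- The partial potential `∑_{k < n} μ^{*k} * 1_{[0,1]}` of the random walk with step law `μ`. -/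
def partialPotential (μ : Measure ℝ) : ℕ → ℝ → ℝ≥0∞
  | 0 => fun _ => 0
  | n + 1 => fun x => (Icc (0 : ℝ) 1).indicator 1 x + ∫⁻ y, partialPotential μ n (x - y) ∂μ

lemma measurable_partialPotential (μ : Measure ℝ) [SFinite μ] (n : ℕ) :
    Measurable (partialPotential μ n) := by
  induction n with
  | zero => exact measurable_const
  | succ n ih =>
    refine (measurable_one.indicator measurableSet_Icc).add ?_
    exact Measurable.lintegral_prod_right' (f := fun q : ℝ × ℝ => partialPotential μ n (q.1 - q.2))
      (ih.comp (measurable_fst.sub measurable_snd))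

lemma lintegral_exp_mul_sub (μ : Measure ℝ) (δ x : ℝ) :
    ∫⁻ y, ENNReal.ofReal (Real.exp (δ * (x - y))) ∂μ
      = ENNReal.ofReal (Real.exp (δ * x)) * ∫⁻ y, ENNReal.ofReal (Real.exp (-(δ * y))) ∂μ := by
  rw [← lintegral_const_mul _ (by fun_prop)]
  refine lintegral_congr fun y => ?_
  rw [← ENNReal.ofReal_mul (Real.exp_pos _).le, ← Real.exp_add]
  ring_nf

lemma partialPotential_le_exp (μ : Measure ℝ) {δ : ℝ} (hδ : 0 ≤ δ) {ρ C : ℝ≥0∞}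
    (hρ : ∫⁻ y, ENNReal.ofReal (Real.exp (-(δ * y))) ∂μ ≤ ρ) (hC : 1 + C * ρ ≤ C)
    (n : ℕ) (x : ℝ) :
    partialPotential μ n x ≤ C * ENNReal.ofReal (Real.exp (δ * x)) := by
  induction n generalizing x with
  | zero => exact zero_le
  | succ n ih =>
    calc (Icc (0 : ℝ) 1).indicator 1 x + ∫⁻ y, partialPotential μ n (x - y) ∂μ
        ≤ ENNReal.ofReal (Real.exp (δ * x))
          + C * (ENNReal.ofReal (Real.exp (δ * x)) * ρ) := by
          gcongr
          · refine indicator_le (g := fun x => ENNReal.ofReal (Real.exp (δ * x)))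
              (fun y hy => ?_) x
            rw [Pi.one_apply, ENNReal.one_le_ofReal]
            exact Real.one_le_exp (mul_nonneg hδ hy.1)
          · calc _ ≤ ∫⁻ y, C * ENNReal.ofReal (Real.exp (δ * (x - y))) ∂μ :=
                  lintegral_mono fun y => ih _
              _ = C * (ENNReal.ofReal (Real.exp (δ * x))
                    * ∫⁻ y, ENNReal.ofReal (Real.exp (-(δ * y))) ∂μ) := by
                  rw [lintegral_const_mul _ (by fun_prop), lintegral_exp_mul_sub]
              _ ≤ _ := by gcongr
      _ = (1 + C * ρ) * ENNReal.ofReal (Real.exp (δ * x)) := by ring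
      _ ≤ _ := by gcongr

/-- Maximum principle: the potential of `[0,1]` is bounded by its values on `[0,1]`. -/
lemma partialPotential_le (μ : Measure ℝ) [IsProbabilityMeasure μ] {δ : ℝ} (hδ : 0 ≤ δ)
    {ρ C : ℝ≥0∞} (hρ : ∫⁻ y, ENNReal.ofReal (Real.exp (-(δ * y))) ∂μ ≤ ρ)
    (hC : 1 + C * ρ ≤ C) (n : ℕ) (x : ℝ) :
    partialPotential μ n x ≤ C * ENNReal.ofReal (Real.exp δ) := by
  induction n generalizing x with
  | zero => exact zero_le
  | succ n ih =>
    by_cases hx : x ∈ Icc (0 : ℝ) 1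
    · refine (partialPotential_le_exp μ hδ hρ hC (n + 1) x).trans ?_
      gcongr
      nlinarith [hx.2]
    · calc (Icc (0 : ℝ) 1).indicator 1 x + ∫⁻ y, partialPotential μ n (x - y) ∂μ
          ≤ 0 + ∫⁻ _, C * ENNReal.ofReal (Real.exp δ) ∂μ := by
            rw [indicator_of_notMem hx]
            gcongr
            exact ih _
        _ = _ := by simp

/-- The average of `f` over `[x - 1, x]`. -/
def windowAverage (f : ℝ → ℝ≥0∞) (x : ℝ) : ℝ≥0∞ :=
  ∫⁻ u, (Icc (0 : ℝ) 1).indicator 1 (x - u) * f u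

/-- The convolution of `partialPotential μ n` with `ψ`. -/
def potentialConv (μ : Measure ℝ) (ψ : ℝ → ℝ≥0∞) (n : ℕ) (x : ℝ) : ℝ≥0∞ :=
  ∫⁻ u, partialPotential μ n (x - u) * ψ u

lemma potentialConv_zero (μ : Measure ℝ) (ψ : ℝ → ℝ≥0∞) (x : ℝ) :
    potentialConv μ ψ 0 x = 0 := by
  simp [potentialConv, partialPotential]

lemma measurable_potentialConv (μ : Measure ℝ) [SFinite μ] {ψ : ℝ → ℝ≥0∞} (hψ : Measurable ψ)
    (n : ℕ) : Measurable (potentialConv μ ψ n) := by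
  refine Measurable.lintegral_prod_right'
    (f := fun q : ℝ × ℝ => partialPotential μ n (q.1 - q.2) * ψ q.2) ?_
  exact ((measurable_partialPotential μ n).comp
    (measurable_fst.sub measurable_snd)).mul (hψ.comp measurable_snd)

lemma potentialConv_succ (μ : Measure ℝ) [SFinite μ] {ψ : ℝ → ℝ≥0∞} (hψ : Measurable ψ)
    (n : ℕ) (x : ℝ) :
    potentialConv μ ψ (n + 1) x
      = windowAverage ψ x + ∫⁻ y, potentialConv μ ψ n (x - y) ∂μ := by
  have hP := measurable_partialPotential μ n
  have hI : Measurable ((Icc (0 : ℝ) 1).indicator (1 : ℝ → ℝ≥0∞)) :=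
    measurable_one.indicator measurableSet_Icc
  simp only [potentialConv, partialPotential, windowAverage, add_mul]
  rw [lintegral_add_left (by fun_prop), lintegral_lintegral_swap]
  · congr 1
    refine lintegral_congr fun u => ?_
    rw [← lintegral_mul_const _ (by fun_prop)]
    refine lintegral_congr fun y => ?_
    rw [sub_right_comm]
  · refine Measurable.aemeasurable ?_
    exact (hP.comp ((measurable_const.sub measurable_fst).sub measurable_snd)).mul
      (hψ.comp measurable_snd)

lemma potentialConv_le (μ : Measure ℝ) [IsProbabilityMeasure μ] {δ : ℝ} (hδ : 0 ≤ δ)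
    {ρ C : ℝ≥0∞} (hρ : ∫⁻ y, ENNReal.ofReal (Real.exp (-(δ * y))) ∂μ ≤ ρ)
    (hC : 1 + C * ρ ≤ C) {ψ : ℝ → ℝ≥0∞} (hψ : Measurable ψ) (n : ℕ) (x : ℝ) :
    potentialConv μ ψ n x ≤ C * ENNReal.ofReal (Real.exp δ) * ∫⁻ u, ψ u := by
  rw [← lintegral_const_mul _ hψ]
  refine lintegral_mono fun u => ?_
  gcongr
  exact partialPotential_le μ hδ hρ hC n _

lemma windowAverage_mono {f g : ℝ → ℝ≥0∞} (h : ∀ x, f x ≤ g x) (x : ℝ) :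
    windowAverage f x ≤ windowAverage g x :=
  lintegral_mono fun u => mul_le_mul_right (h u) _

lemma windowAverage_lintegral_sub (μ : Measure ℝ) [SFinite μ] {f : ℝ → ℝ≥0∞} (hf : Measurable f)
    (x : ℝ) :
    windowAverage (fun u => ∫⁻ y, f (u - y) ∂μ) x = ∫⁻ y, windowAverage f (x - y) ∂μ := by
  have hI : Measurable ((Icc (0 : ℝ) 1).indicator (1 : ℝ → ℝ≥0∞)) :=
    measurable_one.indicator measurableSet_Icc
  have h1 : ∀ y, windowAverage f (x - y)
      = ∫⁻ u, (Icc (0 : ℝ) 1).indicator 1 (x - u) * f (u - y) := fun y => by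
    rw [windowAverage, ← lintegral_sub_right_eq_self _ y]
    refine lintegral_congr fun u => ?_
    rw [sub_sub_sub_cancel_right]
  simp only [h1]
  rw [lintegral_lintegral_swap]
  · refine lintegral_congr fun u => ?_
    rw [lintegral_const_mul _ (by fun_prop)]
  · refine Measurable.aemeasurable ?_
    exact (hI.comp (measurable_const.sub measurable_snd)).mul
      (hf.comp (measurable_snd.sub measurable_fst))

lemma windowAverage_le_of_le {f : ℝ → ℝ≥0∞} {x : ℝ} {c : ℝ≥0∞}
    (h : ∀ u ≤ x, f u ≤ c) : windowAverage f x ≤ c := by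
  calc windowAverage f x ≤ ∫⁻ u, (Icc (x - 1) x).indicator (fun _ => c) u := by
        refine lintegral_mono fun u => ?_
        by_cases hu : u ∈ Icc (x - 1) x
        · have : x - u ∈ Icc (0 : ℝ) 1 := ⟨by linarith [hu.2], by linarith [hu.1]⟩
          simpa [hu, this] using h u hu.2
        · have : x - u ∉ Icc (0 : ℝ) 1 := fun h' =>
            hu ⟨by linarith [h'.2], by linarith [h'.1]⟩
          simp [hu, this]
    _ = c := by simp [lintegral_indicator measurableSet_Icc]

lemma le_windowAverage_of_le {f : ℝ → ℝ≥0∞} {x : ℝ} {c : ℝ≥0∞}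
    (h : ∀ u ∈ Icc (x - 1) x, c ≤ f u) : c ≤ windowAverage f x := by
  calc c = ∫⁻ u, (Icc (x - 1) x).indicator (fun _ => c) u := by
        simp [lintegral_indicator measurableSet_Icc]
    _ ≤ windowAverage f x := by
        refine lintegral_mono fun u => ?_
        by_cases hu : u ∈ Icc (x - 1) x
        · have : x - u ∈ Icc (0 : ℝ) 1 := ⟨by linarith [hu.2], by linarith [hu.1]⟩
          simpa [hu, this] using h u hu
        · simp [hu]

lemma ENNReal.le_of_forall_le_add_pow_mul {a b c ρ : ℝ≥0∞} (hρ : ρ < 1) (hc : c ≠ ∞)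
    (h : ∀ n : ℕ, a ≤ b + ρ ^ n * c) : a ≤ b := by
  have h1 : Tendsto (fun n : ℕ => b + ρ ^ n * c) atTop (nhds (b + 0 * c)) :=
    tendsto_const_nhds.add (ENNReal.Tendsto.mul_const
      (ENNReal.tendsto_pow_atTop_nhds_zero_of_lt_one hρ) (Or.inr hc))
  simpa using ge_of_tendsto' h1 h

/-- A subsolution of the renewal equation with forcing term `ψ` has window averages bounded by a
multiple of `∫ ψ`. -/
lemma windowAverage_le_of_renewal_subsolution (μ : Measure ℝ) [IsProbabilityMeasure μ] {δ : ℝ}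
    (hδ : 0 ≤ δ) {ρ C : ℝ≥0∞} (hρ : ∫⁻ y, ENNReal.ofReal (Real.exp (-(δ * y))) ∂μ ≤ ρ)
    (hρ1 : ρ < 1) (hC : 1 + C * ρ ≤ C) {ψ f : ℝ → ℝ≥0∞} (hψ : Measurable ψ) (hf : Measurable f)
    (hsub : ∀ x, f x ≤ ψ x + ∫⁻ y, f (x - y) ∂μ) {B : ℝ≥0∞} (hB : B ≠ ∞)
    (hfB : ∀ x, f x ≤ B * ENNReal.ofReal (Real.exp (δ * x))) (x : ℝ) :
    windowAverage f x ≤ C * ENNReal.ofReal (Real.exp δ) * ∫⁻ u, ψ u := by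
  have key : ∀ (n : ℕ) (x : ℝ), windowAverage f x
      ≤ potentialConv μ ψ n x + ρ ^ n * (B * ENNReal.ofReal (Real.exp (δ * x))) := by
    intro n
    induction n with
    | zero =>
      intro x
      rw [potentialConv_zero, zero_add, pow_zero, one_mul]
      refine windowAverage_le_of_le fun u hu => (hfB u).trans ?_
      gcongr
    | succ n ih =>
      intro x
      calc windowAverage f x
          ≤ windowAverage (fun x => ψ x + ∫⁻ y, f (x - y) ∂μ) x := windowAverage_mono hsub x
        _ = windowAverage ψ x + ∫⁻ y, windowAverage f (x - y) ∂μ := by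
            rw [← windowAverage_lintegral_sub μ hf]
            simp only [windowAverage, mul_add]
            refine lintegral_add_left ?_ _
            exact ((measurable_one.indicator measurableSet_Icc).comp
              (measurable_const.sub measurable_id)).mul hψ
        _ ≤ windowAverage ψ x + ∫⁻ y, (potentialConv μ ψ n (x - y)
              + ρ ^ n * (B * ENNReal.ofReal (Real.exp (δ * (x - y))))) ∂μ := by
            gcongr
            exact ih _
        _ = windowAverage ψ x + ∫⁻ y, potentialConv μ ψ n (x - y) ∂μ
              + ρ ^ n * (B * (ENNReal.ofReal (Real.exp (δ * x))
                * ∫⁻ y, ENNReal.ofReal (Real.exp (-(δ * y))) ∂μ)) := by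
            rw [lintegral_add_right _ (by fun_prop), lintegral_const_mul _ (by fun_prop),
              lintegral_const_mul _ (by fun_prop), lintegral_exp_mul_sub, add_assoc]
        _ ≤ potentialConv μ ψ (n + 1) x
              + ρ ^ n * (B * (ENNReal.ofReal (Real.exp (δ * x)) * ρ)) := by
            rw [potentialConv_succ μ hψ]
            gcongr
        _ = _ := by ring
  refine ENNReal.le_of_forall_le_add_pow_mul hρ1 (c := B * ENNReal.ofReal (Real.exp (δ * x)))
    (by finiteness) fun n => (key n x).trans ?_
  gcongr
  exact potentialConv_le μ hδ hρ hC hψ n x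

/-- Comparison for supersolutions of the renewal equation on `[0, ∞)`: overshoots larger than `A`
are controlled by the forcing term `ψ`. -/
lemma le_add_of_renewal_supersolution (μ : Measure ℝ) [IsProbabilityMeasure μ] {δ : ℝ}
    (hδ : 0 ≤ δ) {ρ C : ℝ≥0∞} (hρ : ∫⁻ y, ENNReal.ofReal (Real.exp (-(δ * y))) ∂μ = ρ)
    (hρ1 : ρ < 1) (hC : 1 + C * ρ ≤ C) {ψ f : ℝ → ℝ≥0∞} (hψ : Measurable ψ)
    {A : ℝ} {c : ℝ≥0∞} (hc : c ≠ ∞)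
    (hψA : ∀ x, 0 ≤ x → μ (Ioi (x + A)) ≤ windowAverage ψ x)
    (hneg : ∀ x, -A ≤ x → x < 0 → c ≤ f x)
    (hsuper : ∀ x, 0 ≤ x → ∫⁻ y, f (x - y) ∂μ ≤ f x) {x : ℝ} (hx : -A ≤ x) :
    c ≤ f x + c * (C * ENNReal.ofReal (Real.exp δ) * ∫⁻ u, ψ u) := by
  have key : ∀ (n : ℕ) (x : ℝ), -A ≤ x → c ≤ f x + c * potentialConv μ ψ n x
      + c * (ρ ^ n * ENNReal.ofReal (Real.exp (δ * (x + A)))) := by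
    intro n
    induction n with
    | zero =>
      intro x hx
      refine le_add_left ?_
      rw [pow_zero, one_mul]
      refine le_mul_of_one_le_right (zero_le) ?_
      rw [ENNReal.one_le_ofReal]
      exact Real.one_le_exp (mul_nonneg hδ (by linarith))
    | succ n ih =>
      intro x hx
      rcases lt_or_ge x 0 with h0 | h0
      · exact (hneg x hx h0).trans (by rw [add_assoc]; exact le_self_add)
      have hm := measurable_potentialConv μ hψ n
      calc c = c * μ (Iic (x + A)) + c * μ (Ioi (x + A)) := by
            rw [← mul_add, ← compl_Iic, measure_add_measure_compl measurableSet_Iic]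
            simp
        _ = ∫⁻ y in Iic (x + A), c ∂μ + c * μ (Ioi (x + A)) := by simp
        _ ≤ ∫⁻ y in Iic (x + A), (f (x - y) + c * potentialConv μ ψ n (x - y)
              + c * (ρ ^ n * ENNReal.ofReal (Real.exp (δ * (x - y + A))))) ∂μ
              + c * windowAverage ψ x := by
            gcongr ?_ + c * ?_
            · refine setLIntegral_mono' measurableSet_Iic fun y hy => ih _ ?_
              have : y ≤ x + A := hy
              linarith
            · exact hψA x h0
        _ ≤ ∫⁻ y, (f (x - y) + c * potentialConv μ ψ n (x - y)
              + c * (ρ ^ n * ENNReal.ofReal (Real.exp (δ * ((x + A) - y))))) ∂μ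
              + c * windowAverage ψ x := by
            simp only [sub_add_eq_add_sub]
            gcongr
            exact Measure.restrict_le_self
        _ = ∫⁻ y, f (x - y) ∂μ + c * (windowAverage ψ x + ∫⁻ y, potentialConv μ ψ n (x - y) ∂μ)
              + c * (ρ ^ n * (ENNReal.ofReal (Real.exp (δ * (x + A))) * ρ)) := by
            rw [lintegral_add_right _ (by fun_prop), lintegral_add_right _ (by fun_prop),
              lintegral_const_mul _ (by fun_prop), lintegral_const_mul _ (by fun_prop),
              lintegral_const_mul _ (by fun_prop), lintegral_exp_mul_sub, hρ]
            ring
        _ ≤ f x + c * potentialConv μ ψ (n + 1) x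
              + c * (ρ ^ n * (ENNReal.ofReal (Real.exp (δ * (x + A))) * ρ)) := by
            rw [potentialConv_succ μ hψ]
            gcongr
            exact hsuper x h0
        _ = _ := by ring
  refine ENNReal.le_of_forall_le_add_pow_mul hρ1
    (c := c * ENNReal.ofReal (Real.exp (δ * (x + A)))) (by finiteness) fun n =>
      (key n x hx).trans ?_
  rw [mul_left_comm (ρ ^ n)]
  gcongr
  exact potentialConv_le μ hδ hρ.le hC hψ n x

section Tail

variable {Θ : Type*} [MeasurableSpace Θ]

lemma lintegral_rpow_lt_one (ν : Measure Θ) [IsProbabilityMeasure ν] {M : Θ → ℝ}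
    (hM : Measurable M) (hM0 : ∀ p, 0 ≤ M p) {κ θ : ℝ} (hθ : 0 < θ) (hθκ : θ < κ)
    (h1 : ∫⁻ p, ENNReal.ofReal (M p ^ κ) ∂ν = 1) (hne : ¬ ∀ᵐ p ∂ν, M p = 1) :
    ∫⁻ p, ENNReal.ofReal (M p ^ θ) ∂ν < 1 := by
  have hκ : 0 < κ := hθ.trans hθκ
  set α := θ / κ with hα
  have hα0 : 0 < α := by positivity
  have hα1 : α < 1 := (div_lt_one hκ).2 hθκ
  have hpow : ∀ p, M p ^ θ = (1 + (M p ^ κ - 1)) ^ α := fun p => by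
    rw [add_sub_cancel, ← Real.rpow_mul (hM0 p), hα, mul_div_cancel₀ _ hκ.ne']
  have hle : ∀ p, M p ^ θ ≤ α * M p ^ κ + (1 - α) := fun p => by
    have := rpow_one_add_le_one_add_mul_self (s := M p ^ κ - 1)
      (by linarith [Real.rpow_nonneg (hM0 p) κ]) hα0.le hα1.le
    rw [hpow]
    linarith
  have hlt : ∀ p, M p ≠ 1 → M p ^ θ < α * M p ^ κ + (1 - α) := fun p hp => by
    have hs : M p ^ κ - 1 ≠ 0 := fun h => hp <| by
      have h2 : M p ^ κ = 1 := by linarith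
      rwa [← Real.one_rpow κ, Real.rpow_left_inj (hM0 p) zero_le_one hκ.ne'] at h2
    have := rpow_one_add_lt_one_add_mul_self (s := M p ^ κ - 1)
      (by linarith [Real.rpow_nonneg (hM0 p) κ]) hs hα0 hα1
    rw [hpow]
    linarith
  have hg : ∫⁻ p, ENNReal.ofReal (α * M p ^ κ + (1 - α)) ∂ν = 1 := by
    have : ∀ p, ENNReal.ofReal (α * M p ^ κ + (1 - α))
        = ENNReal.ofReal α * ENNReal.ofReal (M p ^ κ) + ENNReal.ofReal (1 - α) := fun p => by
      rw [ENNReal.ofReal_add (mul_nonneg hα0.le (Real.rpow_nonneg (hM0 p) _)) (by linarith),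
        ENNReal.ofReal_mul hα0.le]
    simp only [this]
    rw [lintegral_add_right _ measurable_const, lintegral_const_mul _ (by fun_prop), h1]
    simp only [mul_one, lintegral_const, measure_univ]
    rw [← ENNReal.ofReal_add hα0.le (by linarith)]
    simp
  rw [← hg]
  have hmono : ∀ p, ENNReal.ofReal (M p ^ θ) ≤ ENNReal.ofReal (α * M p ^ κ + (1 - α)) :=
    fun p => ENNReal.ofReal_le_ofReal (hle p)
  refine lintegral_strict_mono_of_ae_le_of_frequently_ae_lt (by fun_prop) ?_
    (ae_of_all _ hmono) ?_
  · exact ((lintegral_mono hmono).trans_lt (hg ▸ ENNReal.one_lt_top)).ne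
  · intro h
    refine hne (h.mono fun p hp => ?_)
    by_contra h'
    refine hp ((ENNReal.ofReal_lt_ofReal_iff_of_nonneg ?_).2 (hlt p h')).ne
    exact Real.rpow_nonneg (hM0 p) _

lemma tendsto_measure_Ioi_atTop (η : Measure ℝ) [IsFiniteMeasure η] :
    Tendsto (fun t => η (Ioi t)) atTop (nhds 0) := by
  have h := tendsto_measure_iInter_atTop (μ := η) (s := fun t : ℝ => Ioi t)
    (fun t => measurableSet_Ioi.nullMeasurableSet) (fun a b h => Ioi_subset_Ioi h)
    ⟨0, measure_ne_top _ _⟩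
  have h0 : ⋂ t : ℝ, Ioi t = ∅ := by
    ext x
    simp only [mem_iInter, mem_Ioi, mem_empty_iff_false, iff_false, not_forall, not_lt]
    exact ⟨x, le_rfl⟩
  rwa [h0, measure_empty] at h

lemma ENNReal.add_mul_inv_one_sub_mul {a ρ : ℝ≥0∞} (hρ : ρ < 1) :
    a + a * (1 - ρ)⁻¹ * ρ = a * (1 - ρ)⁻¹ := by
  have h0 : 1 - ρ ≠ 0 := (tsub_pos_of_lt hρ).ne'
  have h1 : 1 - ρ ≠ ∞ := (tsub_le_self.trans_lt ENNReal.one_lt_top).ne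
  calc a + a * (1 - ρ)⁻¹ * ρ = a * (1 - ρ)⁻¹ * (1 - ρ) + a * (1 - ρ)⁻¹ * ρ := by
        rw [mul_assoc a _ (1 - ρ), ENNReal.inv_mul_cancel h0 h1, mul_one]
    _ = a * (1 - ρ)⁻¹ := by rw [← mul_add, tsub_add_cancel_of_le hρ.le, mul_one]

lemma measure_Ioi_le_rpow_neg (ν : Measure Θ) [IsProbabilityMeasure ν] (η : Measure ℝ)
    [IsProbabilityMeasure η] {M Q : Θ → ℝ} (hM : Measurable M) (hQ : Measurable Q)
    (hM0 : ∀ p, 0 ≤ M p) {θ : ℝ} (hθ : 0 < θ)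
    (hMθ : ∫⁻ p, ENNReal.ofReal (M p ^ θ) ∂ν < 1)
    (hQθ : ∫⁻ p, ENNReal.ofReal (Q p ^ θ) ∂ν ≠ ∞)
    (hU : ∀ t, 0 < t → η (Ioi t) ≤ (ν.prod η) {q | t < Q q.1 + M q.1 * q.2}) :
    ∃ D : ℝ≥0∞, D ≠ ∞ ∧ ∀ t, 0 < t → η (Ioi t) ≤ D * ENNReal.ofReal (t ^ (-θ)) := by
  obtain ⟨δ, hδ0, hδ1, hδ⟩ : ∃ δ : ℝ, 0 < δ ∧ δ < 1 ∧
      ENNReal.ofReal ((1 - δ) ^ (-θ)) * ∫⁻ p, ENNReal.ofReal (M p ^ θ) ∂ν < 1 := by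
    have hc : Tendsto (fun δ : ℝ => ENNReal.ofReal ((1 - δ) ^ (-θ))
        * ∫⁻ p, ENNReal.ofReal (M p ^ θ) ∂ν) (nhds 0)
        (nhds (ENNReal.ofReal ((1 - 0) ^ (-θ)) * ∫⁻ p, ENNReal.ofReal (M p ^ θ) ∂ν)) := by
      refine ENNReal.Tendsto.mul_const (ENNReal.tendsto_ofReal ?_) (Or.inr hMθ.ne_top)
      have : ContinuousAt (fun δ : ℝ => (1 - δ) ^ (-θ)) 0 :=
        ContinuousAt.rpow_const (by fun_prop) (Or.inl (by norm_num))
      exact this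
    have hev := hc.eventually (gt_mem_nhds (show _ < (1 : ℝ≥0∞) by simpa using hMθ))
    have hev' := (hev.filter_mono (nhdsWithin_le_nhds (s := Ioi 0))).and
      (Ioo_mem_nhdsGT (zero_lt_one' ℝ))
    obtain ⟨δ, h1, h2⟩ := hev'.exists
    exact ⟨δ, h2.1, h2.2, h1⟩
  have hδ1' : 0 < 1 - δ := by linarith
  set ρ := ENNReal.ofReal ((1 - δ) ^ (-θ)) * ∫⁻ p, ENNReal.ofReal (M p ^ θ) ∂ν with hρ
  set a := ENNReal.ofReal (δ ^ (-θ)) * ∫⁻ p, ENNReal.ofReal (Q p ^ θ) ∂ν with ha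
  have ha' : a ≠ ∞ := ENNReal.mul_ne_top ENNReal.ofReal_ne_top hQθ
  set D := a * (1 - ρ)⁻¹ with hD
  have hD' : a + D * ρ = D := ENNReal.add_mul_inv_one_sub_mul hδ
  have hDtop : D ≠ ∞ :=
    ENNReal.mul_ne_top ha' (ENNReal.inv_ne_top.2 (tsub_pos_of_lt hδ).ne')
  have key : ∀ b, 0 < b → ∀ (n : ℕ) (t : ℝ), 0 < t → η (Ioi t)
      ≤ η (Ioi b) + (D + ρ ^ n * ENNReal.ofReal (b ^ θ)) * ENNReal.ofReal (t ^ (-θ)) := by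
    intro b hb n
    induction n with
    | zero =>
      intro t ht
      rcases lt_or_ge t b with h | h
      · refine le_add_left (prob_le_one.trans ?_)
        calc (1 : ℝ≥0∞) ≤ ENNReal.ofReal (b ^ θ) * ENNReal.ofReal (t ^ (-θ)) := by
              rw [← ENNReal.ofReal_mul (by positivity), ENNReal.one_le_ofReal,
                Real.rpow_neg ht.le, ← div_eq_mul_inv, ← Real.div_rpow hb.le ht.le]
              exact Real.one_le_rpow ((one_le_div ht).2 h.le) hθ.le
          _ ≤ _ := by
              gcongr
              simp
      · exact (measure_mono (Ioi_subset_Ioi h)).trans le_self_add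
    | succ n ih =>
      intro t ht
      set E := D + ρ ^ n * ENNReal.ofReal (b ^ θ) with hE
      have hfib : ∀ p, η {y | t < Q p + M p * y} ≤
          ENNReal.ofReal (δ ^ (-θ)) * ENNReal.ofReal (t ^ (-θ)) * ENNReal.ofReal (Q p ^ θ)
          + (η (Ioi b) + E * ENNReal.ofReal ((1 - δ) ^ (-θ)) * ENNReal.ofReal (t ^ (-θ))
            * ENNReal.ofReal (M p ^ θ)) := by
        intro p
        by_cases hp : δ * t < Q p
        · have hQp : 0 < Q p := lt_trans (by positivity) hp
          refine le_add_right (prob_le_one.trans ?_)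
          rw [← ENNReal.ofReal_mul (by positivity), ← ENNReal.ofReal_mul (by positivity),
            ENNReal.one_le_ofReal, ← Real.mul_rpow hδ0.le ht.le,
            Real.rpow_neg (by positivity), mul_comm, ← div_eq_mul_inv,
            ← Real.div_rpow hQp.le (by positivity)]
          exact Real.one_le_rpow ((one_le_div (by positivity)).2 hp.le) hθ.le
        · refine le_add_left ?_
          rcases (hM0 p).eq_or_lt with h0 | h0
          · have : {y : ℝ | t < Q p + M p * y} = ∅ := by
              ext y
              simp only [← h0, mem_ofPred_eq, mem_empty_iff_false, iff_false]
              nlinarith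
            simp [this]
          · have hsub : {y : ℝ | t < Q p + M p * y} ⊆ Ioi ((1 - δ) * t / M p) := by
              intro y hy
              rw [mem_Ioi, div_lt_iff₀ h0]
              have hy' : t < Q p + M p * y := hy
              linarith
            refine (measure_mono hsub).trans ((ih _ (by positivity)).trans_eq ?_)
            rw [mul_assoc E, mul_assoc E, ← ENNReal.ofReal_mul (by positivity),
              ← ENNReal.ofReal_mul (by positivity), Real.div_rpow (by positivity) h0.le,
              Real.mul_rpow hδ1'.le ht.le, Real.rpow_neg h0.le, div_inv_eq_mul]
      calc η (Ioi t) ≤ ∫⁻ p, η {y | t < Q p + M p * y} ∂ν := by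
            refine (hU t ht).trans_eq ?_
            rw [Measure.prod_apply (measurableSet_lt measurable_const (by fun_prop))]
            rfl
        _ ≤ _ := lintegral_mono hfib
        _ = a * ENNReal.ofReal (t ^ (-θ)) + (η (Ioi b) + E * ρ * ENNReal.ofReal (t ^ (-θ))) := by
            rw [lintegral_add_left (by fun_prop), lintegral_add_left (by fun_prop),
              lintegral_const_mul _ (by fun_prop), lintegral_const_mul _ (by fun_prop), ha, hρ]
            simp only [lintegral_const, measure_univ, mul_one]
            ring
        _ = η (Ioi b) + (a + D * ρ + ρ ^ (n + 1) * ENNReal.ofReal (b ^ θ))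
              * ENNReal.ofReal (t ^ (-θ)) := by rw [hE]; ring
        _ = _ := by rw [hD']
  refine ⟨D, hDtop, fun t ht => ?_⟩
  have h1 : ∀ b, 0 < b → η (Ioi t) ≤ η (Ioi b) + D * ENNReal.ofReal (t ^ (-θ)) := fun b hb => by
    refine ENNReal.le_of_forall_le_add_pow_mul hδ
      (c := ENNReal.ofReal (b ^ θ) * ENNReal.ofReal (t ^ (-θ))) (by finiteness) fun n =>
        (key b hb n t ht).trans_eq ?_
    ring
  have h2 := (tendsto_measure_Ioi_atTop η).add_const (D * ENNReal.ofReal (t ^ (-θ)))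
  rw [zero_add] at h2
  exact ge_of_tendsto h2 ((eventually_gt_atTop 0).mono h1)

lemma lintegral_rpow_ne_top_of_measure_Ioi_le (η : Measure ℝ) [IsProbabilityMeasure η]
    (hη : ∀ᵐ y ∂η, 0 ≤ y) {p θ : ℝ} (hp : 0 < p) (hpθ : p < θ) {D : ℝ≥0∞} (hD : D ≠ ∞)
    (h : ∀ t, 0 < t → η (Ioi t) ≤ D * ENNReal.ofReal (t ^ (-θ))) :
    ∫⁻ y, ENNReal.ofReal (y ^ p) ∂η ≠ ∞ := by
  rw [lintegral_rpow_eq_lintegral_meas_lt_mul η hη aemeasurable_id hp]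
  refine ENNReal.mul_ne_top ENNReal.ofReal_ne_top ?_
  rw [← Ioc_union_Ioi_eq_Ioi (zero_le_one' ℝ)]
  refine ((lintegral_union_le _ _ _).trans_lt (ENNReal.add_lt_top.2 ⟨?_, ?_⟩)).ne
  · have hi : IntegrableOn (fun t : ℝ => t ^ (p - 1)) (Ioc 0 1) :=
      (intervalIntegrable_iff_integrableOn_Ioc_of_le zero_le_one).1
        (intervalIntegral.intervalIntegrable_rpow' (by linarith))
    refine lt_of_le_of_lt (lintegral_mono fun t => ?_) hi.lintegral_lt_top
    exact mul_le_of_le_one_left zero_le prob_le_one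
  · have hi : IntegrableOn (fun t : ℝ => t ^ (p - 1 - θ)) (Ioi 1) :=
      integrableOn_Ioi_rpow_of_lt (by linarith) zero_lt_one
    refine lt_of_le_of_lt (setLIntegral_mono' measurableSet_Ioi
      (g := fun t => D * ENNReal.ofReal (t ^ (p - 1 - θ))) fun t ht => ?_) ?_
    · have ht0 : 0 < t := zero_lt_one.trans ht
      calc η {y | t < y} * ENNReal.ofReal (t ^ (p - 1))
          ≤ D * ENNReal.ofReal (t ^ (-θ)) * ENNReal.ofReal (t ^ (p - 1)) := by
            gcongr
            exact h t ht0
        _ = _ := by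
            rw [mul_assoc, ← ENNReal.ofReal_mul (by positivity), ← Real.rpow_add ht0]
            ring_nf
    · rw [lintegral_const_mul' _ _ hD]
      exact ENNReal.mul_lt_top hD.lt_top hi.lintegral_lt_top

lemma setLIntegral_exp_le {a b κ ε : ℝ} (ha : 0 ≤ a) (hb : 0 ≤ b) (hε : 0 < ε) (hε1 : ε ≤ 1)
    (hεκ : ε ≤ κ) :
    ∫⁻ u in {u | a ≤ Real.exp u ∧ Real.exp u < b + a}, ENNReal.ofReal (Real.exp (κ * u))
      ≤ ENNReal.ofReal (ε⁻¹ * (b + a) ^ (κ - ε) * b ^ ε) := by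
  set s : Set ℝ := {u | a ≤ Real.exp u ∧ Real.exp u < b + a} with hs
  have hsm : MeasurableSet s :=
    (measurableSet_le measurable_const Real.measurable_exp).inter
      (measurableSet_lt Real.measurable_exp measurable_const)
  have hexp : ∀ u : ℝ, Real.exp (ε * u) = Real.exp u ^ ε := fun u => by
    rw [← Real.exp_mul, mul_comm]
  have hvol : ∫⁻ u in s, ENNReal.ofReal (ε * Real.exp (ε * u)) ≤ ENNReal.ofReal (b ^ ε) := by
    have hcv := lintegral_image_eq_lintegral_abs_deriv_mul (s := s)
      (f := fun u => Real.exp (ε * u)) (f' := fun u => ε * Real.exp (ε * u)) hsm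
      (fun u _ => by
        have := ((hasDerivAt_id u).const_mul ε).exp
        simp only [id_eq, mul_one] at this
        rw [mul_comm]
        exact this.hasDerivWithinAt)
      (fun u _ v _ h => by simpa [hε.ne'] using h) (fun _ => 1)
    simp only [lintegral_const, one_mul, mul_one, MeasurableSet.univ, Measure.restrict_apply,
      univ_inter] at hcv
    calc ∫⁻ u in s, ENNReal.ofReal (ε * Real.exp (ε * u))
        = volume ((fun u => Real.exp (ε * u)) '' s) := by
          rw [hcv]
          refine lintegral_congr fun u => ?_
          rw [abs_of_pos (by positivity)]
      _ ≤ volume (Icc (a ^ ε) ((b + a) ^ ε)) := by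
          refine measure_mono ?_
          rintro _ ⟨u, hu, rfl⟩
          simp only [hexp]
          exact ⟨Real.rpow_le_rpow ha hu.1 hε.le,
            Real.rpow_le_rpow (Real.exp_pos _).le hu.2.le hε.le⟩
      _ ≤ ENNReal.ofReal (b ^ ε) := by
          rw [Real.volume_Icc]
          refine ENNReal.ofReal_le_ofReal ?_
          linarith [Real.rpow_add_le_add_rpow hb ha hε.le hε1]
  calc ∫⁻ u in s, ENNReal.ofReal (Real.exp (κ * u))
      ≤ ∫⁻ u in s, ENNReal.ofReal (ε⁻¹ * (b + a) ^ (κ - ε))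
          * ENNReal.ofReal (ε * Real.exp (ε * u)) := by
        refine setLIntegral_mono' hsm fun u hu => ?_
        rw [← ENNReal.ofReal_mul (by positivity)]
        refine ENNReal.ofReal_le_ofReal ?_
        calc Real.exp (κ * u) = Real.exp u ^ (κ - ε) * Real.exp (ε * u) := by
              rw [← Real.exp_mul, ← Real.exp_add]
              ring_nf
          _ ≤ (b + a) ^ (κ - ε) * Real.exp (ε * u) := by
              gcongr
              exact hu.2.le
          _ = _ := by field_simp
    _ ≤ ENNReal.ofReal (ε⁻¹ * (b + a) ^ (κ - ε)) * ENNReal.ofReal (b ^ ε) := by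
        rw [lintegral_const_mul _ (by fun_prop)]
        gcongr
    _ = _ := by rw [← ENNReal.ofReal_mul (by positivity)]

lemma add_rpow_mul_rpow_le {m q y κ ε : ℝ} (hm : 0 ≤ m) (hq : 0 ≤ q) (hy : 0 ≤ y)
    (hε : 0 < ε) (hεκ : ε < κ) :
    (q + m * y) ^ (κ - ε) * q ^ ε
      ≤ 2 ^ (κ - ε) * ((m ^ κ + q ^ κ) * y ^ (κ - ε) + q ^ κ) := by
  have hκε : 0 < κ - ε := by linarith
  have hsplit : ∀ z : ℝ, 0 ≤ z → z ^ (κ - ε) * z ^ ε = z ^ κ := fun z hz => by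
    rw [← Real.rpow_add_of_nonneg hz hκε.le hε.le, sub_add_cancel]
  have h1 : (q + m * y) ^ (κ - ε) ≤ 2 ^ (κ - ε) * (q ^ (κ - ε) + (m * y) ^ (κ - ε)) := by
    calc (q + m * y) ^ (κ - ε) ≤ (2 * max q (m * y)) ^ (κ - ε) := by
          refine Real.rpow_le_rpow (by positivity) ?_ hκε.le
          linarith [le_max_left q (m * y), le_max_right q (m * y)]
      _ = 2 ^ (κ - ε) * max q (m * y) ^ (κ - ε) :=
          Real.mul_rpow (by norm_num) (le_max_of_le_left hq)
      _ ≤ _ := by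
          gcongr
          rcases max_cases q (m * y) with h | h <;> rw [h.1]
          · linarith [Real.rpow_nonneg (mul_nonneg hm hy) (κ - ε)]
          · linarith [Real.rpow_nonneg hq (κ - ε)]
  have h2 : m ^ (κ - ε) * q ^ ε ≤ m ^ κ + q ^ κ := by
    rcases le_total m q with h | h
    · calc m ^ (κ - ε) * q ^ ε ≤ q ^ (κ - ε) * q ^ ε := by gcongr
        _ = q ^ κ := hsplit q hq
        _ ≤ _ := le_add_of_nonneg_left (Real.rpow_nonneg hm _)
    · calc m ^ (κ - ε) * q ^ ε ≤ m ^ (κ - ε) * m ^ ε := by gcongr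
        _ = m ^ κ := hsplit m hm
        _ ≤ _ := le_add_of_nonneg_right (Real.rpow_nonneg hq _)
  calc (q + m * y) ^ (κ - ε) * q ^ ε
      ≤ 2 ^ (κ - ε) * (q ^ (κ - ε) + (m * y) ^ (κ - ε)) * q ^ ε := by gcongr
    _ = 2 ^ (κ - ε) * ((m ^ (κ - ε) * q ^ ε) * y ^ (κ - ε) + q ^ (κ - ε) * q ^ ε) := by
        rw [Real.mul_rpow hm hy]
        ring
    _ ≤ _ := by
        rw [hsplit q hq]
        gcongr

lemma lintegral_exp_mul_prod_ne_top (ν : Measure Θ) [IsProbabilityMeasure ν] (η : Measure ℝ)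
    [IsProbabilityMeasure η] (hη : ∀ᵐ y ∂η, 0 ≤ y) {M Q : Θ → ℝ} (hM : Measurable M)
    (hQ : Measurable Q) (hM0 : ∀ p, 0 ≤ M p) (hQ0 : ∀ p, 0 ≤ Q p) {κ ε : ℝ}
    (hε : 0 < ε) (hε1 : ε ≤ 1) (hεκ : ε < κ)
    (hMκ : ∫⁻ p, ENNReal.ofReal (M p ^ κ) ∂ν ≠ ∞) (hQκ : ∫⁻ p, ENNReal.ofReal (Q p ^ κ) ∂ν ≠ ∞)
    (hηκ : ∫⁻ y, ENNReal.ofReal (y ^ (κ - ε)) ∂η ≠ ∞) :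
    ∫⁻ u, ENNReal.ofReal (Real.exp (κ * u)) *
      (ν.prod η) {q | M q.1 * q.2 ≤ Real.exp u ∧ Real.exp u < Q q.1 + M q.1 * q.2} ≠ ∞ := by
  set S : Set (ℝ × (Θ × ℝ)) := {z | M z.2.1 * z.2.2 ≤ Real.exp z.1 ∧
    Real.exp z.1 < Q z.2.1 + M z.2.1 * z.2.2} with hS
  have hSm : MeasurableSet S :=
    (measurableSet_le
      (show Measurable fun z : ℝ × (Θ × ℝ) => M z.2.1 * z.2.2 by fun_prop)
      (show Measurable fun z : ℝ × (Θ × ℝ) => Real.exp z.1 by fun_prop)).inter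
    (measurableSet_lt
      (show Measurable fun z : ℝ × (Θ × ℝ) => Real.exp z.1 by fun_prop)
      (show Measurable fun z : ℝ × (Θ × ℝ) => Q z.2.1 + M z.2.1 * z.2.2 by fun_prop))
  have hmeas : Measurable (S.indicator fun z => ENNReal.ofReal (Real.exp (κ * z.1))) :=
    Measurable.indicator (by fun_prop) hSm
  have hswap : ∫⁻ u, ENNReal.ofReal (Real.exp (κ * u)) *
      (ν.prod η) {q | M q.1 * q.2 ≤ Real.exp u ∧ Real.exp u < Q q.1 + M q.1 * q.2}
      = ∫⁻ q, (∫⁻ u in {u | M q.1 * q.2 ≤ Real.exp u ∧ Real.exp u < Q q.1 + M q.1 * q.2},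
        ENNReal.ofReal (Real.exp (κ * u))) ∂(ν.prod η) := by
    calc _ = ∫⁻ u, ∫⁻ q, S.indicator (fun z => ENNReal.ofReal (Real.exp (κ * z.1))) (u, q)
            ∂(ν.prod η) := by
          refine lintegral_congr fun u => ?_
          rw [← lintegral_indicator_const]
          · rfl
          · exact hSm.preimage measurable_prodMk_left
      _ = ∫⁻ q, (∫⁻ u, S.indicator (fun z => ENNReal.ofReal (Real.exp (κ * z.1))) (u, q))
            ∂(ν.prod η) := lintegral_lintegral_swap hmeas.aemeasurable
      _ = _ := by
          refine lintegral_congr fun q => ?_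
          rw [← lintegral_indicator]
          · rfl
          · exact hSm.preimage measurable_prodMk_right
  rw [hswap]
  set c : ℝ := ε⁻¹ * 2 ^ (κ - ε) with hc
  have hc0 : 0 ≤ c := by positivity
  have hη' : ∀ᵐ q ∂(ν.prod η), 0 ≤ q.2 :=
    (Measure.quasiMeasurePreserving_snd (μ := ν) (ν := η)).ae hη
  have hbound : ∀ᵐ q ∂(ν.prod η),
      ∫⁻ u in {u | M q.1 * q.2 ≤ Real.exp u ∧ Real.exp u < Q q.1 + M q.1 * q.2},
        ENNReal.ofReal (Real.exp (κ * u))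
      ≤ ENNReal.ofReal c * ((ENNReal.ofReal (M q.1 ^ κ) + ENNReal.ofReal (Q q.1 ^ κ))
          * ENNReal.ofReal (q.2 ^ (κ - ε)) + ENNReal.ofReal (Q q.1 ^ κ)) := by
    filter_upwards [hη'] with q hq
    have hMq := hM0 q.1
    have hQq := hQ0 q.1
    refine (setLIntegral_exp_le (mul_nonneg hMq hq) hQq hε hε1 hεκ.le).trans ?_
    rw [← ENNReal.ofReal_add (by positivity) (by positivity),
      ← ENNReal.ofReal_mul (by positivity), ← ENNReal.ofReal_add (by positivity) (by positivity),
      ← ENNReal.ofReal_mul hc0]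
    refine ENNReal.ofReal_le_ofReal ?_
    rw [hc, mul_assoc, mul_assoc]
    refine mul_le_mul_of_nonneg_left ?_ (by positivity)
    exact add_rpow_mul_rpow_le hMq hQq hq hε hεκ
  refine ((lintegral_mono_ae hbound).trans_lt ?_).ne
  rw [lintegral_const_mul _ (by fun_prop), lintegral_add_left (by fun_prop),
    lintegral_prod_mul (f := fun p => ENNReal.ofReal (M p ^ κ) + ENNReal.ofReal (Q p ^ κ))
      (g := fun y => ENNReal.ofReal (y ^ (κ - ε))) (by fun_prop) (by fun_prop),
    lintegral_add_left (by fun_prop),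
    lintegral_prod (fun q => ENNReal.ofReal (Q q.1 ^ κ)) (by fun_prop)]
  simp only [lintegral_const, measure_univ, mul_one]
  exact ENNReal.mul_lt_top ENNReal.ofReal_lt_top (ENNReal.add_lt_top.2
    ⟨ENNReal.mul_lt_top (ENNReal.add_lt_top.2 ⟨hMκ.lt_top, hQκ.lt_top⟩) hηκ.lt_top, hQκ.lt_top⟩)

end Tail

section Tilt

variable {Θ : Type*} [MeasurableSpace Θ]

/-- The law of `log M` under the measure with density `M ^ κ` with respect to `ν`. -/
def tiltedLogLaw (ν : Measure Θ) (M : Θ → ℝ) (κ : ℝ) : Measure ℝ :=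
  (ν.withDensity fun p => ENNReal.ofReal (M p ^ κ)).map fun p => Real.log (M p)

lemma lintegral_tiltedLogLaw (ν : Measure Θ) {M : Θ → ℝ} (hM : Measurable M) (κ : ℝ)
    {g : ℝ → ℝ≥0∞} (hg : Measurable g) :
    ∫⁻ y, g y ∂tiltedLogLaw ν M κ
      = ∫⁻ p, ENNReal.ofReal (M p ^ κ) * g (Real.log (M p)) ∂ν := by
  rw [tiltedLogLaw, lintegral_map hg (by fun_prop),
    lintegral_withDensity_eq_lintegral_mul _ (by fun_prop) (by fun_prop)]
  rfl

lemma isProbabilityMeasure_tiltedLogLaw (ν : Measure Θ) {M : Θ → ℝ} (hM : Measurable M) {κ : ℝ}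
    (h1 : ∫⁻ p, ENNReal.ofReal (M p ^ κ) ∂ν = 1) :
    IsProbabilityMeasure (tiltedLogLaw ν M κ) := by
  constructor
  rw [← lintegral_one, lintegral_tiltedLogLaw ν hM κ measurable_const]
  simpa using h1

lemma lintegral_exp_neg_tiltedLogLaw (ν : Measure Θ) {M : Θ → ℝ} (hM : Measurable M)
    (hM0 : ∀ p, 0 ≤ M p) {κ θ : ℝ} (hκ : κ ≠ 0) (hθ : θ ≠ 0) :
    ∫⁻ y, ENNReal.ofReal (Real.exp (-((κ - θ) * y))) ∂tiltedLogLaw ν M κ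
      = ∫⁻ p, ENNReal.ofReal (M p ^ θ) ∂ν := by
  rw [lintegral_tiltedLogLaw ν hM κ (by fun_prop)]
  refine lintegral_congr fun p => ?_
  rcases (hM0 p).eq_or_lt with h | h
  · simp [← h, Real.zero_rpow hκ, Real.zero_rpow hθ]
  · rw [← ENNReal.ofReal_mul (by positivity), Real.rpow_def_of_pos h, Real.rpow_def_of_pos h,
      ← Real.exp_add]
    ring_nf

lemma lintegral_exp_mul_comp_exp_tiltedLogLaw (ν : Measure Θ) {M : Θ → ℝ} (hM : Measurable M)
    (hM0 : ∀ p, 0 ≤ M p) {κ : ℝ} (hκ : κ ≠ 0) {H : ℝ → ℝ≥0∞} (hH : Measurable H) (x : ℝ) :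
    ∫⁻ y, ENNReal.ofReal (Real.exp (κ * (x - y))) * H (Real.exp (x - y)) ∂tiltedLogLaw ν M κ
      = ENNReal.ofReal (Real.exp (κ * x))
        * ∫⁻ p, (if 0 < M p then H (Real.exp x / M p) else 0) ∂ν := by
  rw [lintegral_tiltedLogLaw ν hM κ (by fun_prop), ← lintegral_const_mul]
  · refine lintegral_congr fun p => ?_
    rcases (hM0 p).eq_or_lt with h | h
    · simp [← h, Real.zero_rpow hκ]
    · rw [if_pos h, ← mul_assoc, ← ENNReal.ofReal_mul (by positivity), Real.rpow_def_of_pos h,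
        ← Real.exp_add, Real.exp_sub, Real.exp_log h]
      ring_nf
  · exact Measurable.ite (measurableSet_lt measurable_const hM) (by fun_prop) measurable_const

lemma measurable_measure_Ioi (η : Measure ℝ) : Measurable fun t => η (Ioi t) :=
  Antitone.measurable fun _ _ h => measure_mono (Ioi_subset_Ioi h)

/-- Upper tail bound for a law that is stochastically dominated by its image under the random
affine map `y ↦ Q + M y`. -/
theorem exists_forall_rpow_mul_measure_Ioi_le (ν : Measure Θ) [IsProbabilityMeasure ν]
    (η : Measure ℝ) [IsProbabilityMeasure η] (hη : ∀ᵐ y ∂η, 0 ≤ y) {M Q : Θ → ℝ}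
    (hM : Measurable M) (hQ : Measurable Q) (hM0 : ∀ p, 0 ≤ M p) (hQ0 : ∀ p, 0 ≤ Q p) {κ : ℝ}
    (hκ : 0 < κ) (hMκ : ∫⁻ p, ENNReal.ofReal (M p ^ κ) ∂ν = 1) (hM1 : ¬ ∀ᵐ p ∂ν, M p = 1)
    (hQκ : ∫⁻ p, ENNReal.ofReal (Q p ^ κ) ∂ν ≠ ∞)
    (hU : ∀ t, 0 < t → η (Ioi t) ≤ (ν.prod η) {q | t < Q q.1 + M q.1 * q.2}) :
    ∃ K : ℝ≥0∞, K ≠ ∞ ∧ ∀ t, 0 < t → ENNReal.ofReal (t ^ κ) * η (Ioi t) ≤ K := by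
  set ε := min κ 1 / 2 with hε
  have hε0 : 0 < ε := by positivity
  have hε1 : ε ≤ 1 := by linarith [min_le_right κ 1]
  have hεκ : ε < κ := by linarith [min_le_left κ 1]
  set θ := κ - ε / 2 with hθ
  have hθ0 : 0 < θ := by linarith
  have hθκ : θ < κ := by linarith
  have hMθ := lintegral_rpow_lt_one ν hM hM0 hθ0 hθκ hMκ hM1
  have hQθ : ∫⁻ p, ENNReal.ofReal (Q p ^ θ) ∂ν ≠ ∞ := by
    have hle : ∀ p, ENNReal.ofReal (Q p ^ θ) ≤ 1 + ENNReal.ofReal (Q p ^ κ) := fun p => by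
      rcases le_total (Q p) 1 with h | h
      · refine le_add_right ?_
        rw [ENNReal.ofReal_le_one]
        exact Real.rpow_le_one (hQ0 p) h hθ0.le
      · exact le_add_left (ENNReal.ofReal_le_ofReal (Real.rpow_le_rpow_of_exponent_le h hθκ.le))
    refine ((lintegral_mono hle).trans_lt ?_).ne
    rw [lintegral_add_left measurable_const]
    simpa using hQκ.lt_top
  obtain ⟨D, hD, hDt⟩ := measure_Ioi_le_rpow_neg ν η hM hQ hM0 hθ0 hMθ hQθ hU
  have hηκ := lintegral_rpow_ne_top_of_measure_Ioi_le η hη (p := κ - ε) (by linarith)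
    (by linarith) hD hDt
  set ψ : ℝ → ℝ≥0∞ := fun u => ENNReal.ofReal (Real.exp (κ * u)) *
      (ν.prod η) {q | M q.1 * q.2 ≤ Real.exp u ∧ Real.exp u < Q q.1 + M q.1 * q.2} with hψ
  have hψint : ∫⁻ u, ψ u ≠ ∞ := lintegral_exp_mul_prod_ne_top ν η hη hM hQ hM0 hQ0 hε0 hε1 hεκ
    (by simp [hMκ]) hQκ hηκ
  have hψm : Measurable ψ := by
    refine Measurable.mul (by fun_prop) ?_
    refine measurable_measure_prodMk_left (s := {z : ℝ × (Θ × ℝ) |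
      M z.2.1 * z.2.2 ≤ Real.exp z.1 ∧ Real.exp z.1 < Q z.2.1 + M z.2.1 * z.2.2}) ?_
    exact (measurableSet_le
      (show Measurable fun z : ℝ × (Θ × ℝ) => M z.2.1 * z.2.2 by fun_prop)
      (show Measurable fun z : ℝ × (Θ × ℝ) => Real.exp z.1 by fun_prop)).inter
      (measurableSet_lt
      (show Measurable fun z : ℝ × (Θ × ℝ) => Real.exp z.1 by fun_prop)
      (show Measurable fun z : ℝ × (Θ × ℝ) => Q z.2.1 + M z.2.1 * z.2.2 by fun_prop))
  have hηm := measurable_measure_Ioi η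
  set f : ℝ → ℝ≥0∞ := fun x => ENNReal.ofReal (Real.exp (κ * x)) * η (Ioi (Real.exp x)) with hf
  have hfm : Measurable f :=
    Measurable.mul (by fun_prop) (hηm.comp Real.measurable_exp)
  have := isProbabilityMeasure_tiltedLogLaw ν hM hMκ
  have hsub : ∀ x, f x ≤ ψ x + ∫⁻ y, f (x - y) ∂tiltedLogLaw ν M κ := by
    intro x
    have hms : MeasurableSet {q : Θ × ℝ | Real.exp x < M q.1 * q.2} :=
      measurableSet_lt measurable_const (by fun_prop)
    have h1 : ∫⁻ y, f (x - y) ∂tiltedLogLaw ν M κ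
        = ENNReal.ofReal (Real.exp (κ * x)) * (ν.prod η) {q | Real.exp x < M q.1 * q.2} := by
      rw [hf, lintegral_exp_mul_comp_exp_tiltedLogLaw ν hM hM0 hκ.ne' hηm,
        Measure.prod_apply hms]
      congr 1
      refine lintegral_congr fun p => ?_
      have hpre : Prod.mk p ⁻¹' {q : Θ × ℝ | Real.exp x < M q.1 * q.2}
          = {y | Real.exp x < M p * y} := rfl
      rw [hpre]
      split_ifs with h
      · congr 1
        ext y
        rw [mem_Ioi, div_lt_iff₀ h, mul_comm y]
        rfl
      · have h0 : M p = 0 := le_antisymm (not_lt.1 h) (hM0 p)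
        simp [h0, (Real.exp_pos x).not_gt]
    rw [h1, hψ, hf, ← mul_add]
    refine mul_le_mul_right ((hU _ (Real.exp_pos x)).trans ?_) _
    refine (measure_mono fun q hq => ?_).trans (measure_union_le _ _)
    rcases le_or_gt (M q.1 * q.2) (Real.exp x) with h | h
    · exact Or.inl ⟨h, hq⟩
    · exact Or.inr h
  have hfD : ∀ x, f x ≤ D * ENNReal.ofReal (Real.exp ((κ - θ) * x)) := by
    intro x
    calc f x ≤ ENNReal.ofReal (Real.exp (κ * x))
          * (D * ENNReal.ofReal (Real.exp x ^ (-θ))) :=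
          mul_le_mul_right (hDt _ (Real.exp_pos x)) _
      _ = _ := by
          rw [mul_left_comm, ← ENNReal.ofReal_mul (by positivity), ← Real.exp_mul,
            ← Real.exp_add]
          ring_nf
  have hρ := lintegral_exp_neg_tiltedLogLaw ν hM hM0 hκ.ne' hθ0.ne'
  have hC := (ENNReal.add_mul_inv_one_sub_mul (a := 1) hMθ).le
  have hδ : 0 ≤ κ - θ := by linarith
  have hw := windowAverage_le_of_renewal_subsolution (tiltedLogLaw ν M κ) hδ
    hρ.le hMθ hC hψm hfm hsub hD hfD
  set K := 1 * (1 - ∫⁻ p, ENNReal.ofReal (M p ^ θ) ∂ν)⁻¹ * ENNReal.ofReal (Real.exp (κ - θ))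
    * ∫⁻ u, ψ u with hK
  have hKtop : K ≠ ∞ := by
    refine ENNReal.mul_ne_top (ENNReal.mul_ne_top ?_ ENNReal.ofReal_ne_top) hψint
    rw [one_mul]
    exact ENNReal.inv_ne_top.2 (tsub_pos_of_lt hMθ).ne'
  refine ⟨ENNReal.ofReal (Real.exp κ) * K, ENNReal.mul_ne_top ENNReal.ofReal_ne_top hKtop,
    fun t ht => ?_⟩
  have hle : ENNReal.ofReal (Real.exp (κ * (Real.log t - 1))) * η (Ioi t) ≤ K := by
    refine le_trans (le_windowAverage_of_le fun u hu => ?_) (hw (Real.log t))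
    refine mul_le_mul' (ENNReal.ofReal_le_ofReal (Real.exp_le_exp.2 ?_))
      (measure_mono (Ioi_subset_Ioi ?_))
    · exact mul_le_mul_of_nonneg_left hu.1 hκ.le
    · rw [← Real.le_log_iff_exp_le ht]
      exact hu.2
  calc ENNReal.ofReal (t ^ κ) * η (Ioi t)
      = ENNReal.ofReal (Real.exp κ)
        * (ENNReal.ofReal (Real.exp (κ * (Real.log t - 1))) * η (Ioi t)) := by
        rw [← mul_assoc, ← ENNReal.ofReal_mul (by positivity), ← Real.exp_add,
          Real.rpow_def_of_pos ht]
        ring_nf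
    _ ≤ _ := by gcongr

lemma tendsto_lintegral_indicator_measure_Ioi (μ : Measure ℝ) [IsFiniteMeasure μ]
    (hμ : ∫⁻ y, ENNReal.ofReal (max y 0) ∂μ ≠ ∞) :
    Tendsto (fun n : ℕ => ∫⁻ u, (Ici (-1 : ℝ)).indicator (fun u => μ (Ioi (u + (n + 1)))) u) atTop
      (nhds 0) := by
  have hm := measurable_measure_Ioi μ
  have hfin : ∫⁻ u, (Ici (-1 : ℝ)).indicator (fun u => μ (Ioi (u + 1))) u ≠ ∞ := by
    have h1 : ∀ u, (Ici (-1 : ℝ)).indicator (fun u => μ (Ioi (u + 1))) u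
        = (Ici (0 : ℝ)).indicator (fun s => μ (Ioi s)) (u + 1) := fun u => by
      by_cases h : -1 ≤ u
      · rw [indicator_of_mem (mem_Ici.2 h), indicator_of_mem (mem_Ici.2 (by linarith))]
      · rw [indicator_of_notMem (by simpa using h), indicator_of_notMem]
        rw [mem_Ici]
        intro h'
        exact h (by linarith)
    simp only [h1]
    rw [lintegral_add_right_eq_self (fun s => (Ici (0 : ℝ)).indicator (fun s => μ (Ioi s)) s) 1,
      lintegral_indicator measurableSet_Ici, ← setLIntegral_congr Ioi_ae_eq_Ici]
    convert hμ using 1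
    rw [lintegral_eq_lintegral_meas_lt μ (ae_of_all _ fun y => le_max_right y 0) (by fun_prop)]
    refine setLIntegral_congr_fun measurableSet_Ioi fun t ht => ?_
    have ht0 : (0 : ℝ) < t := ht
    simp [ht0.not_gt, Ioi_def]
  have hdom := tendsto_lintegral_of_dominated_convergence (μ := volume)
    (F := fun (n : ℕ) u => (Ici (-1 : ℝ)).indicator (fun u => μ (Ioi (u + (n + 1)))) u)
    (f := fun _ => 0) _ (fun n => Measurable.indicator (hm.comp (measurable_add_const ((n : ℝ) + 1)))
      measurableSet_Ici)
    (fun n => ae_of_all _ fun u => indicator_le_indicator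
      (measure_mono (Ioi_subset_Ioi (by linarith [n.cast_nonneg (α := ℝ)])))) hfin
    (ae_of_all _ fun u => by
      have hlim : Tendsto (fun n : ℕ => μ (Ioi (u + ((n : ℝ) + 1)))) atTop (nhds 0) :=
        (tendsto_measure_Ioi_atTop μ).comp (tendsto_atTop_add_const_left _ _
          (tendsto_atTop_add_const_right _ _ tendsto_natCast_atTop_atTop))
      exact tendsto_of_tendsto_of_tendsto_of_le_of_le tendsto_const_nhds hlim
        (fun _ => zero_le) fun n => indicator_le_self' (fun _ _ => zero_le) u)
  simpa using hdom

lemma exists_lt_measure_Ioi_pos (η : Measure ℝ) {r : ℝ} (h : 0 < η (Ioi r)) :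
    ∃ c, r < c ∧ 0 < η (Ioi c) := by
  by_contra! hc
  refine h.ne' ?_
  have hU : Ioi r = ⋃ n : ℕ, Ioi (r + 1 / ((n : ℝ) + 1)) := by
    ext y
    simp only [mem_Ioi, mem_iUnion]
    constructor
    · intro hy
      obtain ⟨n, hn⟩ := exists_nat_one_div_lt (sub_pos.2 hy)
      exact ⟨n, by linarith⟩
    · rintro ⟨n, hn⟩
      have : (0 : ℝ) < 1 / ((n : ℝ) + 1) := by positivity
      linarith
  rw [hU, measure_iUnion_null_iff]
  intro n
  have : (0 : ℝ) < 1 / ((n : ℝ) + 1) := by positivity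
  exact le_antisymm (hc _ (by linarith)) zero_le

/-- Lower tail bound for a law that stochastically dominates the image of its restriction to
`(r, ∞)` under the random linear map `y ↦ M y`. -/
theorem exists_forall_le_rpow_mul_measure_Ioi (ν : Measure Θ) [IsProbabilityMeasure ν]
    (η : Measure ℝ) [IsProbabilityMeasure η] {M : Θ → ℝ}
    (hM : Measurable M) (hM0 : ∀ p, 0 ≤ M p) {κ : ℝ}
    (hκ : 0 < κ) (hMκ : ∫⁻ p, ENNReal.ofReal (M p ^ κ) ∂ν = 1) (hM1 : ¬ ∀ᵐ p ∂ν, M p = 1)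
    (hlog : ∫⁻ p, ENNReal.ofReal (M p ^ κ * max (Real.log (M p)) 0) ∂ν ≠ ∞)
    {r : ℝ} (hr : 0 ≤ r) (hηr : 0 < η (Ioi r))
    (hL : ∀ t, 0 < t → ∫⁻ p, η {y | r < y ∧ t < M p * y} ∂ν ≤ η (Ioi t)) :
    ∃ K : ℝ≥0∞, 0 < K ∧ ∃ b : ℝ, ∀ t, b ≤ t → K ≤ ENNReal.ofReal (t ^ κ) * η (Ioi t) := by
  obtain ⟨b, hrb, hb⟩ := exists_lt_measure_Ioi_pos η hηr
  have hb0 : 0 < b := hr.trans_lt hrb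
  set θ := κ / 2 with hθ
  have hθ0 : 0 < θ := by positivity
  have hMθ := lintegral_rpow_lt_one ν hM hM0 hθ0 (by linarith) hMκ hM1
  have hδ : 0 ≤ κ - θ := by linarith
  have := isProbabilityMeasure_tiltedLogLaw ν hM hMκ
  set μ := tiltedLogLaw ν M κ with hμ
  have hρ := lintegral_exp_neg_tiltedLogLaw ν hM hM0 hκ.ne' hθ0.ne'
  have hC := (ENNReal.add_mul_inv_one_sub_mul (a := 1) hMθ).le
  set C := 1 * (1 - ∫⁻ p, ENNReal.ofReal (M p ^ θ) ∂ν)⁻¹ with hCdef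
  have hCtop : C * ENNReal.ofReal (Real.exp (κ - θ)) ≠ ∞ := by
    refine ENNReal.mul_ne_top ?_ ENNReal.ofReal_ne_top
    rw [hCdef, one_mul]
    exact ENNReal.inv_ne_top.2 (tsub_pos_of_lt hMθ).ne'
  have hμlog : ∫⁻ y, ENNReal.ofReal (max y 0) ∂μ ≠ ∞ := by
    rw [hμ, lintegral_tiltedLogLaw ν hM κ (by fun_prop)]
    convert hlog using 3 with p
    rw [ENNReal.ofReal_mul (Real.rpow_nonneg (hM0 p) _)]
  obtain ⟨n, hn⟩ : ∃ n : ℕ, C * ENNReal.ofReal (Real.exp (κ - θ))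
      * ∫⁻ u, (Ici (-1 : ℝ)).indicator (fun u => μ (Ioi (u + (n + 1)))) u < 2⁻¹ := by
    have ht := ENNReal.Tendsto.const_mul (tendsto_lintegral_indicator_measure_Ioi μ hμlog)
      (Or.inr hCtop)
    rw [mul_zero] at ht
    exact (ht.eventually (gt_mem_nhds (by simp))).exists
  set A : ℝ := n + 1 with hA
  have hA0 : 0 < A := by positivity
  set ψ : ℝ → ℝ≥0∞ := (Ici (-1 : ℝ)).indicator fun u => μ (Ioi (u + A)) with hψ
  have hψm : Measurable ψ :=
    ((measurable_measure_Ioi μ).comp (measurable_add_const A)).indicator measurableSet_Ici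
  have hηm := measurable_measure_Ioi η
  set H : ℝ → ℝ≥0∞ := fun s => min (η (Ioi b)) (η (Ioi (b * s))) with hH
  have hHm : Measurable H := measurable_const.min (hηm.comp (measurable_const_mul b))
  set f : ℝ → ℝ≥0∞ := fun x => ENNReal.ofReal (Real.exp (κ * x)) * H (Real.exp x) with hf
  set c := ENNReal.ofReal (Real.exp (-(κ * A))) * η (Ioi b) with hc
  have hctop : c ≠ ∞ := by finiteness
  have hψA : ∀ x, 0 ≤ x → μ (Ioi (x + A)) ≤ windowAverage ψ x := by
    intro x hx
    refine le_windowAverage_of_le fun u hu => ?_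
    rw [hψ, indicator_of_mem (mem_Ici.2 (by linarith [hu.1]))]
    exact measure_mono (Ioi_subset_Ioi (by linarith [hu.2]))
  have hneg : ∀ x, -A ≤ x → x < 0 → c ≤ f x := by
    intro x hx hx0
    refine mul_le_mul' (ENNReal.ofReal_le_ofReal (Real.exp_le_exp.2 (by nlinarith))) ?_
    refine le_min le_rfl (measure_mono (Ioi_subset_Ioi ?_))
    exact mul_le_of_le_one_right hb0.le (Real.exp_le_one_iff.2 hx0.le)
  have hsuper : ∀ x, 0 ≤ x → ∫⁻ y, f (x - y) ∂μ ≤ f x := by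
    intro x _
    rw [hf, hμ, lintegral_exp_mul_comp_exp_tiltedLogLaw ν hM hM0 hκ.ne' hHm]
    refine mul_le_mul_right (le_min ?_ ?_) _
    · calc ∫⁻ p, (if 0 < M p then H (Real.exp x / M p) else 0) ∂ν
          ≤ ∫⁻ _, η (Ioi b) ∂ν := by
            refine lintegral_mono fun p => ?_
            split_ifs
            · exact min_le_left _ _
            · exact zero_le
        _ = η (Ioi b) := by simp
    · refine le_trans (lintegral_mono fun p => ?_) (hL (b * Real.exp x) (by positivity))
      split_ifs with h
      · rcases le_total r (b * (Real.exp x / M p)) with h' | h'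
        · refine (min_le_right _ _).trans (measure_mono fun y hy => ⟨h'.trans_lt hy, ?_⟩)
          rw [mem_Ioi, ← mul_div_assoc, div_lt_iff₀ h] at hy
          linarith
        · refine (min_le_left _ _).trans (measure_mono fun y hy => ⟨hrb.trans hy, ?_⟩)
          have hy' : b * (Real.exp x / M p) < y := h'.trans_lt (hrb.trans hy)
          rw [← mul_div_assoc, div_lt_iff₀ h] at hy'
          linarith
      · exact zero_le
  have hmain : ∀ x, 0 ≤ x → c / 2 ≤ f x := by
    intro x hx
    have h1 := le_add_of_renewal_supersolution μ hδ hρ hMθ hC hψm hctop hψA hneg hsuper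
      (x := x) (by linarith)
    have h2 : c / 2 + c / 2 ≤ f x + c / 2 := by
      rw [ENNReal.add_halves]
      refine h1.trans ?_
      rw [ENNReal.div_eq_inv_mul, mul_comm _ c]
      gcongr
    exact (ENNReal.add_le_add_iff_right (ENNReal.div_ne_top hctop two_ne_zero)).1 h2
  refine ⟨ENNReal.ofReal (b ^ κ) * (c / 2), ?_, b, fun t ht => ?_⟩
  · refine ENNReal.mul_pos (by simpa using Real.rpow_pos_of_pos hb0 κ) (ENNReal.div_pos ?_ ?_).ne'
    · exact (ENNReal.mul_pos (by simpa using Real.exp_pos _) hb.ne').ne'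
    · exact ENNReal.ofNat_ne_top
  · have ht0 : 0 < t := hb0.trans_le ht
    have hx : 0 ≤ Real.log (t / b) := Real.log_nonneg ((one_le_div hb0).2 ht)
    have hexp : Real.exp (Real.log (t / b)) = t / b := Real.exp_log (by positivity)
    calc ENNReal.ofReal (b ^ κ) * (c / 2)
        ≤ ENNReal.ofReal (b ^ κ) * f (Real.log (t / b)) := by
          gcongr
          exact hmain _ hx
      _ ≤ ENNReal.ofReal (b ^ κ) * (ENNReal.ofReal ((t / b) ^ κ) * η (Ioi t)) := by
          rw [hf]
          dsimp only
          rw [hexp, mul_comm κ, ← Real.rpow_def_of_pos (by positivity)]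
          gcongr
          refine (min_le_right _ _).trans_eq ?_
          rw [mul_div_cancel₀ _ hb0.ne']
      _ = _ := by
          rw [← mul_assoc, ← ENNReal.ofReal_mul (by positivity), ← Real.mul_rpow hb0.le
            (by positivity), mul_div_cancel₀ _ hb0.ne']

end Tilt

/-- **Exact stationary tail index under an affine/max-type sandwich.**  If the random
Lipschitz map `Ψ` satisfies a.s., for all `x`,
`R̲ ∨ (M·d(x₀,x)·1_{(r,∞)}(d(x₀,x))) ≤ d(x₀,Ψ(x)) ≤ R̄ + M·d(x₀,x)`
with nonnegative `M, R̲, R̄` such that `P(R̲ > r) > 0`, `P(R̄ > 0) > 0`, `E R̄^κ < ∞`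
and `M` satisfies (IRT-1)–(IRT-3) for `κ > 0`, then the law of `d(x₀,X₀)` under any
stationary law `π` has exact tail index `κ`. -/
theorem exact_stationary_tail_index
    {𝕏 Θ : Type*}
    [MetricSpace 𝕏] [CompleteSpace 𝕏] [TopologicalSpace.SeparableSpace 𝕏]
    [MeasurableSpace 𝕏] [BorelSpace 𝕏] [MeasurableSpace Θ]
    (hunb : ∀ R : ℝ, ∃ x y : 𝕏, R < dist x y)
    (ν : Measure Θ) [IsProbabilityMeasure ν]
    (Ψ : Θ → 𝕏 → 𝕏) (hΨmeas : Measurable fun q : Θ × 𝕏 => Ψ q.1 q.2)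
    (hΨlip : ∀ p, ∃ K : NNReal, LipschitzWith K (Ψ p))
    (π : Measure 𝕏) [IsProbabilityMeasure π]
    (hπstat : Measure.map (fun q : 𝕏 × Θ => Ψ q.2 q.1) (π.prod ν) = π)
    (x₀ : 𝕏) (r : ℝ) (hr : 0 ≤ r)
    (M Rlo Rhi : Θ → ℝ)
    (hnonneg : ∀ᵐ p ∂ν, 0 ≤ M p ∧ 0 ≤ Rlo p ∧ 0 ≤ Rhi p)
    (hsand : ∀ᵐ p ∂ν, ∀ x : 𝕏,
      max (Rlo p) (if r < dist x₀ x then M p * dist x₀ x else 0) ≤ dist x₀ (Ψ p x) ∧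
      dist x₀ (Ψ p x) ≤ Rhi p + M p * dist x₀ x)
    (κ : ℝ)
    (hRlo : 0 < ν {p | r < Rlo p})
    (hRhi : 0 < ν {p | 0 < Rhi p})
    (hRhiMom : Integrable (fun p => Rhi p ^ κ) ν)
    (hIRT : SatisfiesIRT ν M κ) :
    ExactTailIndex (Measure.map (dist x₀) π) κ := by
  obtain ⟨hκ, hM1, hMlog, hMarith⟩ := hIRT
  have hMint : Integrable (fun p => |M p| ^ κ) ν := by
    by_contra h
    rw [integral_undef h] at hM1
    exact zero_ne_one hM1
  have hMae : AEMeasurable M ν := by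
    refine (hMint.aemeasurable.pow_const κ⁻¹).congr ?_
    filter_upwards [hnonneg] with p hp
    rw [Real.rpow_rpow_inv (abs_nonneg _) hκ.ne', abs_of_nonneg hp.1]
  have hQae : AEMeasurable Rhi ν := by
    refine (hRhiMom.aemeasurable.pow_const κ⁻¹).congr ?_
    filter_upwards [hnonneg] with p hp
    rw [Real.rpow_rpow_inv hp.2.2 hκ.ne']
  set N : Θ → ℝ := fun p => max (hMae.mk M p) 0 with hN
  set Q : Θ → ℝ := fun p => max (hQae.mk Rhi p) 0 with hQ
  have hNm : Measurable N := hMae.measurable_mk.max measurable_const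
  have hQm : Measurable Q := hQae.measurable_mk.max measurable_const
  have hN0 : ∀ p, 0 ≤ N p := fun p => le_max_right _ _
  have hQ0 : ∀ p, 0 ≤ Q p := fun p => le_max_right _ _
  have hMN : ∀ᵐ p ∂ν, M p = N p := by
    filter_upwards [hMae.ae_eq_mk, hnonneg] with p hp hp'
    simp only [hN]
    rw [← hp, max_eq_left hp'.1]
  have hRQ : ∀ᵐ p ∂ν, Rhi p = Q p := by
    filter_upwards [hQae.ae_eq_mk, hnonneg] with p hp hp'
    simp only [hQ]
    rw [← hp, max_eq_left hp'.2.2]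
  have hNκ : ∫⁻ p, ENNReal.ofReal (N p ^ κ) ∂ν = 1 := by
    rw [← ENNReal.ofReal_one, ← hM1, ofReal_integral_eq_lintegral_ofReal hMint
      (ae_of_all _ fun p => Real.rpow_nonneg (abs_nonneg _) _)]
    refine lintegral_congr_ae ?_
    filter_upwards [hMN] with p hp
    rw [hp, abs_of_nonneg (hN0 p)]
  have hQκ : ∫⁻ p, ENNReal.ofReal (Q p ^ κ) ∂ν ≠ ∞ := by
    refine ne_of_eq_of_ne (lintegral_congr_ae ?_) hRhiMom.lintegral_lt_top.ne
    filter_upwards [hRQ] with p hp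
    rw [hp]
  have hNlog : ∫⁻ p, ENNReal.ofReal (N p ^ κ * max (Real.log (N p)) 0) ∂ν ≠ ∞ := by
    refine ne_of_eq_of_ne (lintegral_congr_ae ?_) hMlog.lintegral_lt_top.ne
    filter_upwards [hMN] with p hp
    rw [hp, abs_of_nonneg (hN0 p)]
  have hN1 : ¬ ∀ᵐ p ∂ν, N p = 1 := by
    intro h
    refine (hMarith 0).ne' (measure_eq_zero_iff_ae_notMem.2 ?_)
    filter_upwards [h, hMN] with p hp hp' hmem
    exact hmem.2 0 (by simp [hp', hp])
  have hdm : Measurable (dist x₀) := (continuous_const.dist continuous_id).measurable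
  set η := Measure.map (dist x₀) π with hη
  have : IsProbabilityMeasure η := Measure.isProbabilityMeasure_map hdm.aemeasurable
  have hη0 : ∀ᵐ y ∂η, 0 ≤ y :=
    (ae_map_iff hdm.aemeasurable measurableSet_Ici).2 (ae_of_all _ fun _ => dist_nonneg)
  have hΨm : Measurable fun q : 𝕏 × Θ => Ψ q.2 q.1 := hΨmeas.comp measurable_swap
  have hηprod : ∀ t, η (Ioi t) = (π.prod ν) {q | t < dist x₀ (Ψ q.2 q.1)} := fun t => by
    rw [hη, Measure.map_apply hdm measurableSet_Ioi]
    conv_lhs => rw [← hπstat]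
    rw [Measure.map_apply hΨm (hdm measurableSet_Ioi)]
    rfl
  have hSm : ∀ t, MeasurableSet {q : 𝕏 × Θ | t < dist x₀ (Ψ q.2 q.1)} := fun t =>
    measurableSet_lt measurable_const (hdm.comp hΨm)
  have hηint : ∀ t, η (Ioi t) = ∫⁻ p, π {x | t < dist x₀ (Ψ p x)} ∂ν := fun t => by
    rw [hηprod, Measure.prod_apply_symm (hSm t)]
    rfl
  have hU : ∀ t, 0 < t → η (Ioi t) ≤ (ν.prod η) {q | t < Q q.1 + N q.1 * q.2} := by
    intro t _
    have hm : MeasurableSet {q : Θ × ℝ | t < Q q.1 + N q.1 * q.2} :=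
      measurableSet_lt measurable_const (by fun_prop)
    rw [hηint, Measure.prod_apply hm]
    refine lintegral_mono_ae ?_
    filter_upwards [hsand, hMN, hRQ] with p hp hpN hpQ
    rw [hη, Measure.map_apply hdm (hm.preimage measurable_prodMk_left)]
    refine measure_mono fun x hx => ?_
    have h2 := (hp x).2
    rw [hpN, hpQ] at h2
    exact lt_of_lt_of_le hx h2
  have hL : ∀ t, 0 < t → ∫⁻ p, η {y | r < y ∧ t < N p * y} ∂ν ≤ η (Ioi t) := by
    intro t _
    rw [hηint]
    refine lintegral_mono_ae ?_
    filter_upwards [hsand, hMN] with p hp hpN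
    have hm : MeasurableSet {y : ℝ | r < y ∧ t < N p * y} :=
      (measurableSet_lt measurable_const measurable_id).inter
        (measurableSet_lt measurable_const (measurable_const_mul _))
    rw [hη, Measure.map_apply hdm hm]
    refine measure_mono fun x hx => ?_
    have h1 := (le_max_right _ _).trans (hp x).1
    rw [if_pos hx.1, hpN] at h1
    exact lt_of_lt_of_le hx.2 h1
  have hηr : 0 < η (Ioi r) := by
    refine hRlo.trans_le ?_
    rw [hηprod, Measure.prod_apply (hSm r)]
    calc ν {p | r < Rlo p} = ∫⁻ _, ν {p | r < Rlo p} ∂π := by simp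
      _ ≤ _ := by
        refine lintegral_mono fun x => measure_mono_ae ?_
        filter_upwards [hsand] with p hp hr
        exact lt_of_lt_of_le hr ((le_max_left _ _).trans (hp x).1)
  obtain ⟨K, hK, hKle⟩ := exists_forall_rpow_mul_measure_Ioi_le ν η hη0 hNm hQm hN0 hQ0 hκ hNκ
    hN1 hQκ hU
  obtain ⟨k, hk, b, hkle⟩ := exists_forall_le_rpow_mul_measure_Ioi ν η hNm hN0 hκ hNκ hN1 hNlog
    hr hηr hL
  refine ⟨hκ, hk.trans_le (le_liminf_of_le ?_ ?_), (limsup_le_of_le ?_ ?_).trans_lt hK.lt_top⟩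
  · isBoundedDefault
  · exact (eventually_ge_atTop b).mono hkle
  · isBoundedDefault
  · exact (eventually_gt_atTop 0).mono hKle
end
end
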